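/- arXiv:1508.07022 — 2 statements merged into one kernel-verified Lean document; each statement's English description precedes it below -/
import Mathlib

section
/- There exist a map F : ℝ² → ℝ², a vector ρ ∈ ℝ², and a continuous surjection p : ℝ²/ℤ² → ℝ/ℤ with the following properties. (a) F is real-analytic and bijective with real-analytic inverse, satisfies F(z+m) = F(z)+m for every m ∈ ℤ², and preserves Lebesgue measure; hence F descends to a volume-preserving real-analytic diffeomorphism f of the torus T² = ℝ²/ℤ² isotopic to the identity. (b) The numbers 1, ρ₁, ρ₂ are linearly independent over ℚ, and sup_{z∈ℝ²} |F^n(z) − z − n·ρ|/n → 0 as n → ∞ (so the rotation set of f is the single totally irrational vector ρ). (c) f is minimal: for every z ∈ T², the orbit {f^n(z) : n ∈ ℤ} is dense in T². (d) p semi-conjugates f to the irrational circle rotation by ρ₁: p(f(z)) = p(z) + ρ₁ (mod ℤ) for all z ∈ T². (e) For every x ∈ ℝ/ℤ, the fibre p⁻¹(x) is a pseudo-circle in the following sense: it is a continuum; for every ε > 0 it can be covered by a circular chain of nonempty compact subsets of T² each of diameter less than ε; and every subcontinuum of p⁻¹(x) containing more than one point is indecomposable (in particular p⁻¹(x) itself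 is indecomposable). Consequently the fibres {p⁻¹(x)}_{x∈ℝ/ℤ} form a partition of T² into pseudo-circles that is permuted by f. -/
open MeasureTheory

/-- The projection from the plane to the torus `T² = ℝ²/ℤ²`. -/
noncomputable def torusProj (z : ℝ × ℝ) : AddCircle (1:ℝ) × AddCircle (1:ℝ) :=
  ((z.1 : AddCircle (1:ℝ)), (z.2 : AddCircle (1:ℝ)))

/-- A continuum: a nonempty compact connected set. -/
def IsContinuum {Y : Type*} [TopologicalSpace Y] (K : Set Y) : Prop :=
  IsCompact K ∧ IsConnected K

/-- A continuum `K` is indecomposable if it is not the union of two proper subcontinua. -/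
def Indecomposable {Y : Type*} [TopologicalSpace Y] (K : Set Y) : Prop :=
  ∀ A B : Set Y, IsContinuum A → IsContinuum B → A ∪ B = K → A = K ∨ B = K

/-- A set `S` is a pseudo-circle (in the sense of its defining topological
characterization): it is a continuum, it is circularly chainable by arbitrarily fine
circular chains of nonempty compact sets, and it is hereditarily indecomposable. -/
def IsPseudoCircle {Y : Type*} [MetricSpace Y] (S : Set Y) : Prop :=
  IsContinuum S ∧
  (∀ ε : ℝ, 0 < ε → ∃ (N : ℕ) (_ : 0 < N) (D : ZMod N → Set Y),
    (∀ ℓ, (D ℓ).Nonempty ∧ IsCompact (D ℓ) ∧ Metric.diam (D ℓ) < ε) ∧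
    (∀ k ℓ : ZMod N, (D k ∩ D ℓ).Nonempty ↔ k - ℓ ∈ ({-1, 0, 1} : Set (ZMod N))) ∧
    S ⊆ ⋃ ℓ, D ℓ) ∧
  (∀ K : Set Y, K ⊆ S → IsContinuum K → (∃ x ∈ K, ∃ y ∈ K, x ≠ y) → Indecomposable K)


/-- crookedness of a path for gaps at most `d`, with error `e` -/
def Crk (G : ℝ → ℝ) (d e : ℝ) : Prop :=
  ∀ s t, s ≤ t → |G s - G t| ≤ d → ∃ t' s', s ≤ t' ∧ t' ≤ s' ∧ s' ≤ t ∧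
    |G t' - G t| ≤ e ∧ |G s' - G s| ≤ e

/-- crookedness modulo integers -/
def CrookZ (G : ℝ → ℝ) (e : ℝ) : Prop :=
  ∀ s t, s ≤ t → ∃ t' s', s ≤ t' ∧ t' ≤ s' ∧ s' ≤ t ∧
    (∃ i : ℤ, |G t' - G t - i| ≤ e) ∧ (∃ i : ℤ, |G s' - G s - i| ≤ e)

theorem path_restrict_aux (G : ℝ → ℝ) (hG : Continuous G) (s t : ℝ) (hst : s ≤ t)
    (h : G s ≤ G t) :
    ∃ s1 t1, s ≤ s1 ∧ s1 ≤ t1 ∧ t1 ≤ t ∧ G s1 = G s ∧ G t1 = G t ∧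
      ∀ u, s1 ≤ u → u ≤ t1 → G s ≤ G u ∧ G u ≤ G t := by
  have hc : IsCompact (Set.Icc s t ∩ G ⁻¹' {G t}) :=
    isCompact_Icc.inter_right (isClosed_singleton.preimage hG)
  obtain ⟨t1, ⟨⟨ht1s, ht1t⟩, ht1⟩, hmin⟩ := hc.exists_isLeast ⟨t, ⟨hst, le_rfl⟩, rfl⟩
  have hc2 : IsCompact (Set.Icc s t1 ∩ G ⁻¹' {G s}) :=
    isCompact_Icc.inter_right (isClosed_singleton.preimage hG)
  obtain ⟨s1, ⟨⟨hs1s, hs1t⟩, hs1⟩, hmax⟩ := hc2.exists_isGreatest ⟨s, ⟨le_rfl, ht1s⟩, rfl⟩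
  simp only [Set.mem_preimage, Set.mem_singleton_iff] at ht1 hs1
  refine ⟨s1, t1, hs1s, hs1t, ht1t, hs1, ht1, fun u hu1 hu2 => ⟨?_, ?_⟩⟩
  · by_contra hlt
    push Not at hlt
    obtain ⟨w, ⟨hw1, hw2⟩, hw⟩ := intermediate_value_Icc hu2 hG.continuousOn
      (show G s ∈ Set.Icc (G u) (G t1) from ⟨hlt.le, by rw [ht1]; exact h⟩)
    have := hmax ⟨⟨by linarith, hw2⟩, hw⟩
    have hwu : w = u := by linarith
    rw [hwu] at hw; linarith
  · by_contra hlt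
    push Not at hlt
    obtain ⟨w, ⟨hw1, hw2⟩, hw⟩ := intermediate_value_Icc (hs1s.trans hu1) hG.continuousOn
      (show G t ∈ Set.Icc (G s) (G u) from ⟨h, hlt.le⟩)
    have := hmin ⟨⟨hw1, by linarith⟩, hw⟩
    have hwu : w = u := by linarith
    rw [hwu] at hw; linarith

theorem path_restrict (G : ℝ → ℝ) (hG : Continuous G) (s t : ℝ) (hst : s ≤ t) :
    ∃ s1 t1, s ≤ s1 ∧ s1 ≤ t1 ∧ t1 ≤ t ∧ G s1 = G s ∧ G t1 = G t ∧
      ∀ u, s1 ≤ u → u ≤ t1 → G u ∈ Set.uIcc (G s) (G t) := by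
  rcases le_total (G s) (G t) with h | h
  · obtain ⟨s1, t1, h1, h2, h3, h4, h5, h6⟩ := path_restrict_aux G hG s t hst h
    exact ⟨s1, t1, h1, h2, h3, h4, h5, fun u a b => by
      rw [Set.uIcc_of_le h]; exact h6 u a b⟩
  · obtain ⟨s1, t1, h1, h2, h3, h4, h5, h6⟩ :=
      path_restrict_aux (fun x => - G x) hG.neg s t hst (by simpa using h)
    refine ⟨s1, t1, h1, h2, h3, by simpa using h4, by simpa using h5, fun u a b => by
      rw [Set.uIcc_of_ge h]; have := h6 u a b; exact ⟨by linarith [this.2], by linarith [this.1]⟩⟩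

/-- the zigzag: up `d`, down `d - 1`, repeated -/
noncomputable def zig (d : ℝ) (x : ℝ) : ℝ :=
  (⌊x / (2 * d - 1)⌋ : ℝ) + min (x - (2 * d - 1) * ⌊x / (2 * d - 1)⌋)
    (2 * d - (x - (2 * d - 1) * ⌊x / (2 * d - 1)⌋))

theorem zig_eq (d x : ℝ) (hd : 1 ≤ d) : ∃ (i : ℤ) (u : ℝ), 0 ≤ u ∧ u < 2 * d - 1 ∧
    x = (2 * d - 1) * i + u ∧ zig d x = i + min u (2 * d - u) := by
  have hP : 0 < 2 * d - 1 := by linarith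
  refine ⟨⌊x / (2 * d - 1)⌋, x - (2 * d - 1) * ⌊x / (2 * d - 1)⌋, ?_, ?_, by ring, rfl⟩
  · have := Int.floor_le (x / (2 * d - 1))
    rw [le_div_iff₀ hP] at this; linarith
  · have := Int.lt_floor_add_one (x / (2 * d - 1))
    rw [div_lt_iff₀ hP] at this; linarith

theorem zig_of (d : ℝ) (hd : 1 ≤ d) (i : ℤ) (u : ℝ) (h0 : 0 ≤ u) (h1 : u < 2 * d - 1) :
    zig d ((2 * d - 1) * i + u) = i + min u (2 * d - u) := by
  have hP : 0 < 2 * d - 1 := by linarith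
  have : ⌊((2 * d - 1) * i + u) / (2 * d - 1)⌋ = i := by
    rw [Int.floor_eq_iff, le_div_iff₀ hP, div_lt_iff₀ hP]
    constructor <;> nlinarith
  unfold zig
  rw [this]
  simp

theorem zig_add (d x : ℝ) (hd : 1 ≤ d) : zig d (x + (2 * d - 1)) = zig d x + 1 := by
  obtain ⟨i, u, h0, h1, rfl, h⟩ := zig_eq d x hd
  rw [h]
  have := zig_of d hd (i + 1) u h0 h1
  rw [show (2 * d - 1) * (i:ℝ) + u + (2 * d - 1) = (2 * d - 1) * ((i + 1 : ℤ) : ℝ) + u by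
    push_cast; ring, this]
  push_cast; ring

theorem zig_lip_aux (d x y : ℝ) (hd : 1 ≤ d) (hxy : x ≤ y) : |zig d x - zig d y| ≤ y - x := by
  obtain ⟨i, u, hu0, hu1, hx, hzx⟩ := zig_eq d x hd
  obtain ⟨j, v, hv0, hv1, hy, hzy⟩ := zig_eq d y hd
  rw [hzx, hzy]
  have hP : 0 < 2 * d - 1 := by linarith
  have hij : i ≤ j := by
    by_contra hlt
    push Not at hlt
    have : (j : ℝ) + 1 ≤ i := by exact_mod_cast hlt
    nlinarith
  rcases hij.eq_or_lt with rfl | hlt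
  · rw [abs_le]
    rcases min_cases u (2 * d - u) with ⟨a, b⟩ | ⟨a, b⟩ <;>
    rcases min_cases v (2 * d - v) with ⟨a', b'⟩ | ⟨a', b'⟩ <;>
    rw [a, a'] <;> constructor <;> linarith
  · have h1 : (i : ℝ) + 1 ≤ j := by exact_mod_cast hlt
    have h2 : ((j : ℝ) - (i + 1)) ≤ (2 * d - 1) * (j - (i + 1)) := by nlinarith
    rw [abs_le]
    rcases min_cases u (2 * d - u) with ⟨a, b⟩ | ⟨a, b⟩ <;>
    rcases min_cases v (2 * d - v) with ⟨a', b'⟩ | ⟨a', b'⟩ <;>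
    rw [a, a'] <;> constructor <;> nlinarith

theorem zig_lip (d x y : ℝ) (hd : 1 ≤ d) : |zig d x - zig d y| ≤ |x - y| := by
  rcases le_total x y with h | h
  · rw [abs_sub_comm x y, abs_of_nonneg (sub_nonneg.2 h)]; exact zig_lip_aux d x y hd h
  · rw [abs_sub_comm, abs_of_nonneg (sub_nonneg.2 h)]; exact zig_lip_aux d y x hd h

theorem zig_cont (d : ℝ) (hd : 1 ≤ d) : Continuous (zig d) := by
  have : LipschitzWith 1 (zig d) := LipschitzWith.of_dist_le_mul fun x y => by
    simpa [Real.dist_eq] using zig_lip d x y hd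
  exact this.continuous

theorem zig_key (d a b : ℝ) (hd : 1 ≤ d) (hab : d < b - a)
    (hbt : ∀ c, a ≤ c → c ≤ b → zig d c ∈ Set.uIcc (zig d a) (zig d b))
    (hgap : |zig d a - zig d b| ≤ d + 1) :
    ∃ a1 b1, a ≤ b1 ∧ b1 ≤ a1 ∧ a1 ≤ b ∧ |zig d a1 - zig d a| ≤ 2 ∧ |zig d b1 - zig d b| ≤ 2 := by
  obtain ⟨i, u, hu0, hu1, hx, hzx⟩ := zig_eq d a hd
  obtain ⟨j, v, hv0, hv1, hy, hzy⟩ := zig_eq d b hd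
  have hP : 0 < 2 * d - 1 := by linarith
  have hij : i ≤ j := by
    by_contra hlt
    push Not at hlt
    have : (j : ℝ) + 1 ≤ i := by exact_mod_cast hlt
    nlinarith
  have hd1 : d ≠ 1 ∨ d = 1 := by tauto
  -- peak value and trough value
  have hpeak : ∀ k : ℤ, 1 < d → zig d ((2 * d - 1) * k + d) = k + d := by
    intro k h1
    rw [zig_of d hd k d (by linarith) (by linarith), min_eq_left (by linarith)]
  have htr : ∀ k : ℤ, zig d ((2 * d - 1) * k) = k := by
    intro k
    have := zig_of d hd k 0 le_rfl hP
    rw [min_eq_left (by linarith)] at this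
    simpa using this
  have hpeak' : ∀ k : ℤ, zig d ((2 * d - 1) * k + d) = k + d := by
    intro k
    rcases hd.eq_or_lt with h | h
    · have := htr (k + 1)
      rw [← h] at this ⊢
      push_cast at this
      rw [← this]; congr 1; ring
    · exact hpeak k h
  have hmv : 0 ≤ min v (2 * d - v) := le_min hv0 (by linarith)
  have hmu1 : min u (2 * d - u) ≤ u := min_le_left _ _
  have hmu2 : min u (2 * d - u) ≤ 2 * d - u := min_le_right _ _
  have hmv1 : min v (2 * d - v) ≤ v := min_le_left _ _
  have hmv2 : min v (2 * d - v) ≤ 2 * d - v := min_le_right _ _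
  rcases hij.eq_or_lt with rfl | hlt
  · exfalso
    have hp := hbt ((2 * d - 1) * i + d) (by linarith) (by linarith)
    rw [hpeak', Set.mem_uIcc, hzx, hzy] at hp
    rcases hp with hp | hp
    · linarith [hp.2]
    · linarith [hp.2]
  · have h1 : (i : ℝ) + 1 ≤ j := by exact_mod_cast hlt
    have htm := hbt ((2 * d - 1) * j) (by nlinarith) (by linarith)
    rw [htr, Set.mem_uIcc, hzx, hzy] at htm
    by_cases hcon : a ≤ (2 * d - 1) * (j - 1 : ℤ) + d
    · have hpm := hbt _ hcon (by push_cast; linarith)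
      rw [hpeak', Set.mem_uIcc, hzx, hzy] at hpm
      push_cast at hpm hcon
      rw [hzx, hzy] at hgap
      rcases le_total (i + min u (2 * d - u)) (j + min v (2 * d - v)) with hle | hle
      · rw [abs_le] at hgap
        refine ⟨(2 * d - 1) * j, (2 * d - 1) * (j - 1 : ℤ) + d, by push_cast; linarith,
          by push_cast; linarith, by linarith, ?_, ?_⟩
        · rw [htr, hzx, abs_le]
          rcases hpm with hpm | hpm <;> rcases htm with htm | htm <;> constructor <;> linarith
        · rw [hpeak', hzy, abs_le]
          push_cast
          rcases hpm with hpm | hpm <;> rcases htm with htm | htm <;> constructor <;> linarith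
      · exfalso
        have e1 : (j : ℝ) - 1 + d ≤ i + min u (2 * d - u) := by
          rcases hpm with hpm | hpm <;> linarith
        have e2 : min v (2 * d - v) = 0 := by
          rcases htm with htm | htm <;> linarith
        have e3 : v = 0 := by
          rcases min_cases v (2 * d - v) with ⟨a', b'⟩ | ⟨a', b'⟩ <;> linarith
        have e4 : (j : ℝ) = i + 1 := by linarith
        rw [e4] at hy e1
        linarith
    · push_cast at hcon
      push Not at hcon
      have e4 : (j : ℝ) = i + 1 := by
        have : j < i + 2 := by
          by_contra h
          push Not at h
          have : (i : ℝ) + 2 ≤ j := by exact_mod_cast h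
          nlinarith
        have : j = i + 1 := by omega
        exact_mod_cast this
      exfalso
      rw [e4] at hy hcon htm
      have hud : d < u := by linarith
      rw [min_eq_right (by linarith : 2 * d - u ≤ u)] at htm
      rcases htm with htm | htm
      · linarith [htm.1]
      · have e2 : min v (2 * d - v) = 0 := by
          linarith
        have e3 : v = 0 := by
          rcases min_cases v (2 * d - v) with ⟨a', b'⟩ | ⟨a', b'⟩ <;> linarith
        linarith

theorem crk_step (G : ℝ → ℝ) (hG : Continuous G) (d : ℝ) (hd : 1 ≤ d) (h : Crk G d 2) :
    Crk (fun x => zig d (G x)) (d + 1) 2 := by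
  intro s0 t0 hst0 hgap0
  obtain ⟨s, t, h1, hst, h3, h4, h5, h6⟩ :=
    path_restrict (fun x => zig d (G x)) ((zig_cont d hd).comp hG) s0 t0 hst0
  simp only at h4 h5 h6 hgap0 ⊢
  rw [← h4, ← h5] at hgap0 h6
  rw [← h4, ← h5]
  suffices H : ∃ t' s', s ≤ t' ∧ t' ≤ s' ∧ s' ≤ t ∧
      |zig d (G t') - zig d (G t)| ≤ 2 ∧ |zig d (G s') - zig d (G s)| ≤ 2 by
    obtain ⟨t', s', a, b, c, e, f⟩ := H
    exact ⟨t', s', by linarith, b, by linarith, e, f⟩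
  by_cases hab : |G s - G t| ≤ d
  · obtain ⟨t', s', a, b, c, e, f⟩ := h s t hst hab
    exact ⟨t', s', a, b, c, (zig_lip d _ _ hd).trans e, (zig_lip d _ _ hd).trans f⟩
  · push Not at hab
    rcases le_total (G s) (G t) with hle | hle
    · rw [abs_sub_comm, abs_of_nonneg (sub_nonneg.2 hle)] at hab
      obtain ⟨a1, b1, k1, k2, k3, k4, k5⟩ := zig_key d (G s) (G t) hd hab (by
        intro c hc1 hc2
        obtain ⟨w, ⟨hw1, hw2⟩, rfl⟩ := intermediate_value_Icc hst hG.continuousOn ⟨hc1, hc2⟩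
        exact h6 w hw1 hw2) hgap0
      obtain ⟨t', ⟨m1, m2⟩, rfl⟩ := intermediate_value_Icc hst hG.continuousOn
        (show b1 ∈ Set.Icc _ _ from ⟨k1, k2.trans k3⟩)
      obtain ⟨s', ⟨m3, m4⟩, rfl⟩ := intermediate_value_Icc m2 hG.continuousOn
        (show a1 ∈ Set.Icc _ _ from ⟨k2, k3⟩)
      exact ⟨t', s', m1, m3, m4, k5, k4⟩
    · rw [abs_of_nonneg (sub_nonneg.2 hle)] at hab
      obtain ⟨a1, b1, k1, k2, k3, k4, k5⟩ := zig_key d (G t) (G s) hd hab (by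
        intro c hc1 hc2
        obtain ⟨w, ⟨hw1, hw2⟩, rfl⟩ := intermediate_value_Icc' hst hG.continuousOn ⟨hc1, hc2⟩
        rw [Set.uIcc_comm]
        exact h6 w hw1 hw2) (by rwa [abs_sub_comm])
      obtain ⟨t', ⟨m1, m2⟩, rfl⟩ := intermediate_value_Icc' hst hG.continuousOn
        (show a1 ∈ Set.Icc _ _ from ⟨k1.trans k2, k3⟩)
      obtain ⟨s', ⟨m3, m4⟩, rfl⟩ := intermediate_value_Icc' m2 hG.continuousOn
        (show b1 ∈ Set.Icc _ _ from ⟨k1, k2⟩)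
      exact ⟨t', s', m1, m3, m4, k4, k5⟩

theorem crk_exists (n : ℕ) : ∃ (W : ℝ → ℝ) (L : ℕ), 0 < L ∧ Continuous W ∧
    (∀ x, W (x + L) = W x + 1) ∧ Crk W (n + 1) 2 := by
  induction n with
  | zero =>
    refine ⟨id, 1, one_pos, continuous_id, fun x => by simp, ?_⟩
    intro s t hst h
    simp only [id] at h ⊢
    refine ⟨s, t, le_rfl, hst, le_rfl, ?_, ?_⟩
    · norm_num at h; linarith
    · norm_num at h; rw [abs_sub_comm]; linarith
  | succ n ih =>
    obtain ⟨W, L, hL, hW, hper, hc⟩ := ih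
    have hd : (1 : ℝ) ≤ (n : ℝ) + 1 := by linarith [Nat.cast_nonneg (α := ℝ) n]
    have hk : ∀ (k : ℕ) x, W (x + k * L) = W x + k := by
      intro k
      induction k with
      | zero => intro x; simp
      | succ k ihk =>
        intro x
        rw [show x + ((k + 1 : ℕ) : ℝ) * L = (x + k * L) + L by push_cast; ring, hper, ihk]
        push_cast; ring
    refine ⟨fun x => zig (n + 1) (W x), (2 * n + 1) * L, by positivity,
      (zig_cont _ hd).comp hW, fun x => ?_, ?_⟩
    · have := hk (2 * n + 1) x
      push_cast at this ⊢
      rw [this, show W x + (2 * (n : ℝ) + 1) = W x + (2 * ((n : ℝ) + 1) - 1) by ring, zig_add _ _ hd]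
    · have := crk_step W hW (n + 1) hd hc
      push_cast
      exact this

theorem crookZ_of_up (g : ℝ → ℝ) (hg : Continuous g) (e : ℝ) (he : 0 ≤ e) (s t : ℝ) (hst : s ≤ t)
    (h : g s + 2 ≤ g t) : ∃ t' s', s ≤ t' ∧ t' ≤ s' ∧ s' ≤ t ∧
    (∃ i : ℤ, |g t' - g t - i| ≤ e) ∧ (∃ i : ℤ, |g s' - g s - i| ≤ e) := by
  have f1 := Int.floor_le (g t - g s)
  have f2 := Int.lt_floor_add_one (g t - g s)
  have f3 : (0 : ℝ) ≤ ⌊g t - g s⌋ := by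
    have : 0 ≤ ⌊g t - g s⌋ := Int.floor_nonneg.2 (by linarith)
    exact_mod_cast this
  obtain ⟨t', ⟨m1, m2⟩, ht'⟩ := intermediate_value_Icc hst hg.continuousOn
    (show g t - ⌊g t - g s⌋ ∈ Set.Icc _ _ from ⟨by linarith, by linarith⟩)
  obtain ⟨s', ⟨m3, m4⟩, hs'⟩ := intermediate_value_Icc m2 hg.continuousOn
    (show g s + 1 ∈ Set.Icc _ _ from ⟨by linarith, by linarith⟩)
  refine ⟨t', s', m1, m3, m4, ⟨-⌊g t - g s⌋, ?_⟩, ⟨1, ?_⟩⟩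
  · rw [ht']; push_cast; ring_nf; simpa using he
  · rw [hs']; push_cast; ring_nf; simpa using he

theorem crookZ_exists (e : ℝ) (he : 0 < e) : ∃ g : ℝ → ℝ, Continuous g ∧
    (∀ x, g (x + 1) = g x + 1) ∧ CrookZ g e := by
  obtain ⟨N, hN⟩ := exists_nat_gt (2 / e)
  have hN0 : (0 : ℝ) < N := lt_trans (by positivity) hN
  obtain ⟨W, L, hL, hW, hper, hc⟩ := crk_exists (2 * N)
  have hk : ∀ (k : ℕ) x, W (x + k * L) = W x + k := by
    intro k
    induction k with
    | zero => intro x; simp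
    | succ k ihk =>
      intro x
      rw [show x + ((k + 1 : ℕ) : ℝ) * L = (x + k * L) + L by push_cast; ring, hper, ihk]
      push_cast; ring
  have hL' : (0 : ℝ) < L := by exact_mod_cast hL
  have hcont : Continuous fun x : ℝ => W (N * L * x) / N := by fun_prop
  refine ⟨fun x => W (N * L * x) / N, hcont, fun x => ?_, ?_⟩
  · beta_reduce
    rw [show (N : ℝ) * L * (x + 1) = N * L * x + N * L by ring, hk]
    field_simp
  · intro s t hst
    rcases le_total (W (N * L * s) / N + 2) (W (N * L * t) / N) with h1 | h1
    · exact crookZ_of_up _ hcont e he.le s t hst h1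
    rcases le_total (-(W (N * L * s) / N) + 2) (-(W (N * L * t) / N)) with h2 | h2
    · obtain ⟨t', s', a, b, c, ⟨i, hi⟩, ⟨j, hj⟩⟩ :=
        crookZ_of_up (fun x => -(W (N * L * x) / N)) hcont.neg e he.le s t hst h2
      refine ⟨t', s', a, b, c, ⟨-i, ?_⟩, ⟨-j, ?_⟩⟩
      · rw [← abs_neg]; push_cast; convert hi using 2; ring
      · rw [← abs_neg]; push_cast; convert hj using 2; ring
    · obtain ⟨t', s', a, b, c, q1, q2⟩ := hc (N * L * s) (N * L * t) (by gcongr) (by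
        have e1 : W (N * L * s) = N * (W (N * L * s) / N) := by field_simp
        have e2 : W (N * L * t) = N * (W (N * L * t) / N) := by field_simp
        push_cast
        rw [e1, e2, abs_le]; constructor <;> nlinarith)
      have hNL : (0 : ℝ) < N * L := by positivity
      have f : ∀ x : ℝ, N * L * (x / (N * L)) = x := fun x => by field_simp
      have h2N : 2 / N ≤ e := by
        rw [div_le_iff₀ hN0]; rw [div_lt_iff₀ he] at hN; linarith
      refine ⟨t' / (N * L), s' / (N * L), ?_, by gcongr, ?_, ⟨0, ?_⟩, ⟨0, ?_⟩⟩
      · rw [le_div_iff₀ hNL]; linarith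
      · rw [div_le_iff₀ hNL]; linarith
      · beta_reduce
        rw [f, Int.cast_zero, sub_zero, ← sub_div, abs_div, abs_of_pos hN0]
        exact (div_le_div_of_nonneg_right q1 hN0.le).trans h2N
      · beta_reduce
        rw [f, Int.cast_zero, sub_zero, ← sub_div, abs_div, abs_of_pos hN0]
        exact (div_le_div_of_nonneg_right q2 hN0.le).trans h2N

/-- entire, one-periodic, real on the real line -/
structure EntPer (Φ : ℝ → ℝ) (Φc : ℂ → ℂ) : Prop where
  diff : Differentiable ℂ Φc
  real : ∀ x : ℝ, Φc x = Φ x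
  per : ∀ (z : ℂ) (j : ℤ), Φc (z + j) = Φc z
  perR : ∀ (x : ℝ) (j : ℤ), Φ (x + j) = Φ x
  bdd : ∃ C : ℝ, ∀ x, |Φ x| ≤ C
  cont : Continuous Φ

theorem trig_span (P : C(AddCircle (1:ℝ), ℂ))
    (hP : P ∈ Submodule.span ℂ (Set.range (fourier (T := (1:ℝ))))) :
    ∃ A B : ℂ → ℂ, Differentiable ℂ A ∧ Differentiable ℂ B ∧ (∀ z, A (z + 1) = A z) ∧
      (∀ z, B (z + 1) = B z) ∧ (∀ x : ℝ, A x = P (x : AddCircle (1:ℝ))) ∧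
      (∀ x : ℝ, B x = (starRingEnd ℂ) (P (x : AddCircle (1:ℝ)))) := by
  induction hP using Submodule.span_induction with
  | mem x hx =>
    obtain ⟨n, rfl⟩ := hx
    have key : ∀ (n : ℤ) (z : ℂ), Complex.exp (2 * Real.pi * Complex.I * n * (z + 1)) =
        Complex.exp (2 * Real.pi * Complex.I * n * z) := by
      intro n z
      rw [show 2 * (Real.pi : ℂ) * Complex.I * n * (z + 1) = 2 * Real.pi * Complex.I * n * z +
        n * (2 * Real.pi * Complex.I) by ring, Complex.exp_periodic.int_mul]
    refine ⟨fun z => Complex.exp (2 * Real.pi * Complex.I * n * z),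
      fun z => Complex.exp (2 * Real.pi * Complex.I * (-n : ℤ) * z), by fun_prop, by fun_prop,
      key n, key (-n), fun x => ?_, fun x => ?_⟩
    · rw [fourier_coe_apply]; simp
    · rw [← fourier_neg, fourier_coe_apply]; simp
  | zero => exact ⟨0, 0, by simp, by simp, by simp, by simp, by simp, by simp⟩
  | add x y _ _ hx hy =>
    obtain ⟨A, B, a1, a2, a3, a4, a5, a6⟩ := hx
    obtain ⟨A', B', b1, b2, b3, b4, b5, b6⟩ := hy
    exact ⟨A + A', B + B', a1.add b1, a2.add b2, by simp [a3, b3], by simp [a4, b4],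
      by simp [a5, b5], by simp [a6, b6]⟩
  | smul c x _ hx =>
    obtain ⟨A, B, a1, a2, a3, a4, a5, a6⟩ := hx
    exact ⟨c • A, (starRingEnd ℂ c) • B, a1.const_smul _, a2.const_smul _, by simp [a3],
      by simp [a4], by simp [a5], by simp [a6]⟩

theorem per_int (A : ℂ → ℂ) (h : ∀ z, A (z + 1) = A z) (z : ℂ) (j : ℤ) : A (z + j) = A z := by
  have : Function.Periodic A 1 := h
  simpa using this.int_mul j z

theorem trig_approx (φ : ℝ → ℝ) (hφ : Continuous φ) (hper : ∀ x, φ (x + 1) = φ x) (e : ℝ)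
    (he : 0 < e) : ∃ (Φ : ℝ → ℝ) (Φc : ℂ → ℂ), EntPer Φ Φc ∧ ∀ x, |Φ x - φ x| ≤ e := by
  have hp : Function.Periodic (fun x => (φ x : ℂ)) 1 := fun x => by simp [hper]
  let q : C(AddCircle (1:ℝ), ℂ) := ⟨hp.lift, by
    apply continuous_coinduced_dom.2
    show Continuous (fun x : ℝ => hp.lift (x : AddCircle (1:ℝ)))
    simp only [Function.Periodic.lift_coe]
    fun_prop⟩
  have hq : q ∈ (Submodule.span ℂ (Set.range (fourier (T := (1:ℝ))))).topologicalClosure := by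
    rw [span_fourier_closure_eq_top]; trivial
  obtain ⟨P, hP, hd⟩ := Metric.mem_closure_iff.1 hq e he
  obtain ⟨A, B, a1, a2, a3, a4, a5, a6⟩ := trig_span P hP
  have hre : ∀ x : ℝ, ((A x + B x) / 2) = ((P (x : AddCircle (1:ℝ))).re : ℂ) := by
    intro x
    rw [a5, a6, Complex.add_conj]; push_cast; ring
  refine ⟨fun x => (P (x : AddCircle (1:ℝ))).re, fun z => (A z + B z) / 2, ⟨?_, hre, ?_, ?_, ?_, ?_⟩, ?_⟩
  · exact (a1.add a2).div_const 2
  · intro z j; rw [per_int A a3, per_int B a4]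
  · intro x j
    have : ((x + j : ℝ) : AddCircle (1:ℝ)) = (x : AddCircle (1:ℝ)) := by
      rw [AddCircle.coe_add]
      have : ((j : ℝ) : AddCircle (1:ℝ)) = 0 := by
        rw [AddCircle.coe_eq_zero_iff]; exact ⟨j, by simp⟩
      rw [this, add_zero]
    simp only [this]
  · exact ⟨‖P‖, fun x => (Complex.abs_re_le_norm _).trans (P.norm_coe_le_norm _)⟩
  · have : Continuous (fun x : ℝ => P (x : AddCircle (1:ℝ))) :=
      P.continuous.comp (AddCircle.continuous_mk' 1)
    exact Complex.continuous_re.comp this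
  · intro x
    have h1 : dist (q (x : AddCircle (1:ℝ))) (P (x : AddCircle (1:ℝ))) ≤ dist q P :=
      ContinuousMap.dist_apply_le_dist _
    have h2 : q (x : AddCircle (1:ℝ)) = φ x := rfl
    have h3 : |(P (x : AddCircle (1:ℝ))).re - φ x| ≤ ‖P (x : AddCircle (1:ℝ)) - φ x‖ := by
      have := Complex.abs_re_le_norm (P (x : AddCircle (1:ℝ)) - φ x)
      simpa using this
    rw [h2, dist_comm, dist_eq_norm] at h1
    linarith

theorem exists_crooked (e : ℝ) (he : 0 < e) : ∃ (Φ : ℝ → ℝ) (Φc : ℂ → ℂ), EntPer Φ Φc ∧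
    CrookZ (fun u => u - Φ u) e := by
  obtain ⟨g, hg, hper, hc⟩ := crookZ_exists (e / 2) (by linarith)
  obtain ⟨Φ, Φc, h1, h2⟩ := trig_approx (fun x => x - g x) (by fun_prop)
    (fun x => by rw [hper]; ring) (e / 4) (by linarith)
  refine ⟨Φ, Φc, h1, fun s t hst => ?_⟩
  obtain ⟨t', s', a, b, c, ⟨i, hi⟩, ⟨j, hj⟩⟩ := hc s t hst
  have k1 := fun x => abs_le.1 (h2 x)
  rw [abs_le] at hi hj
  refine ⟨t', s', a, b, c, ⟨i, ?_⟩, ⟨j, ?_⟩⟩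
  · rw [abs_le]; constructor <;> linarith [(k1 t').1, (k1 t').2, (k1 t).1, (k1 t).2]
  · rw [abs_le]; constructor <;> linarith [(k1 s').1, (k1 s').2, (k1 s).1, (k1 s).2]


/-- The integration functional on continuous functions on `[0, 2π]`. -/
theorem exists_intCLM : ∃ J : C(Set.Icc (0:ℝ) (2*Real.pi), ℂ) →L[ℂ] ℂ, ∀ (φ : ℝ → ℂ) (hφ : Continuous φ),
    J ⟨fun x => φ x, hφ.comp continuous_subtype_val⟩ = ∫ θ in (0:ℝ)..(2*Real.pi), φ θ := by
  have hInteg : ∀ g : C(Set.Icc (0:ℝ) (2*Real.pi), ℂ), Integrable (fun x => g x)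
      (Measure.comap Subtype.val (volume : Measure ℝ)) := by
    intro g
    have : IsFiniteMeasure (Measure.comap (Subtype.val : Set.Icc (0:ℝ) (2*Real.pi) → ℝ) (volume : Measure ℝ)) := by
      constructor
      rw [Measure.comap_apply _ Subtype.val_injective (fun s hs => measurableSet_Icc.subtype_image hs) _ MeasurableSet.univ]
      rw [Set.image_univ, Subtype.range_coe]; exact measure_Icc_lt_top
    exact g.continuous.integrable_of_hasCompactSupport (HasCompactSupport.of_compactSpace _)
  have : IsFiniteMeasure (Measure.comap (Subtype.val : Set.Icc (0:ℝ) (2*Real.pi) → ℝ) (volume : Measure ℝ)) := by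
    constructor
    rw [Measure.comap_apply _ Subtype.val_injective (fun s hs => measurableSet_Icc.subtype_image hs) _ MeasurableSet.univ]
    rw [Set.image_univ, Subtype.range_coe]; exact measure_Icc_lt_top
  let L : C(Set.Icc (0:ℝ) (2*Real.pi), ℂ) →ₗ[ℂ] ℂ :=
    { toFun := fun g => ∫ x, g x ∂(Measure.comap Subtype.val (volume : Measure ℝ))
      map_add' := fun g h => by
        simp only [ContinuousMap.add_apply]
        exact integral_add (hInteg g) (hInteg h)
      map_smul' := fun c g => by
        simp only [ContinuousMap.smul_apply, RingHom.id_apply]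
        exact integral_smul c _ }
  refine ⟨L.mkContinuous ((Measure.comap (Subtype.val : Set.Icc (0:ℝ) (2*Real.pi) → ℝ) (volume : Measure ℝ)).real Set.univ) ?_, ?_⟩
  · intro g
    have := norm_integral_le_of_norm_le_const (μ := Measure.comap (Subtype.val : Set.Icc (0:ℝ) (2*Real.pi) → ℝ) (volume : Measure ℝ)) (f := fun x => g x) (C := ‖g‖) (Filter.Eventually.of_forall (fun x => g.norm_coe_le_norm x))
    exact this.trans_eq (mul_comm _ _)
  · intro φ hφ
    show (∫ x : Set.Icc (0:ℝ) (2*Real.pi), φ x ∂(Measure.comap Subtype.val (volume : Measure ℝ))) = _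
    rw [integral_subtype_comap measurableSet_Icc φ, integral_Icc_eq_integral_Ioc,
      intervalIntegral.integral_of_le (by positivity)]

theorem osgood (f : ℂ × ℂ → ℂ) (hf : Continuous f) (h1 : ∀ w, Differentiable ℂ (fun z => f (z, w)))
    (h2 : ∀ z, Differentiable ℂ (fun w => f (z, w))) (a b : ℂ) : AnalyticAt ℂ f (a, b) := by
  obtain ⟨J, hJ⟩ := exists_intCLM
  let X := Set.Icc (0:ℝ) (2*Real.pi)
  have hX : Nonempty X := ⟨⟨0, by constructor <;> positivity⟩⟩
  let e : C(X, ℂ) := ⟨fun x => circleMap b 1 x, (continuous_circleMap b 1).comp continuous_subtype_val⟩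
  let fe : C(ℂ × X, ℂ) := ⟨fun q => f (q.1, circleMap b 1 q.2), by
    have := continuous_circleMap b 1
    fun_prop⟩
  let u : C(ℂ, C(X, ℂ)) := fe.curry
  have hu : ∀ z x, u z x = f (z, circleMap b 1 x) := fun z x => rfl
  have huA : AnalyticAt ℂ u a := by
    have hci : CircleIntegrable u a (1 : NNReal) := u.continuous.continuousOn.circleIntegrable (by simp)
    have hA := (hasFPowerSeriesOn_cauchy_integral hci one_pos).analyticAt
    refine hA.congr ?_
    filter_upwards [Metric.ball_mem_nhds a one_pos] with z hz
    have hne : ∀ θ, circleMap a 1 θ - z ≠ 0 := by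
      intro θ h
      have := circleMap_mem_sphere a zero_le_one θ
      rw [sub_eq_zero.1 h] at this
      rw [Metric.mem_ball] at hz; rw [Metric.mem_sphere] at this
      linarith
    ext x
    rw [hu]
    have := ((h1 (circleMap b 1 x)).diffContOnCl (s := Metric.ball a 1)).two_pi_i_inv_smul_circleIntegral_sub_inv_smul hz
    rw [← this]
    simp only [ContinuousMap.smul_apply]
    congr 1
    have hev := (ContinuousMap.evalCLM ℂ x : C(X, ℂ) →L[ℂ] ℂ).intervalIntegral_comp_comm (μ := volume) (a := 0) (b := 2 * Real.pi)
      (f := fun θ => deriv (circleMap a 1) θ • (circleMap a 1 θ - z)⁻¹ • u (circleMap a 1 θ)) (by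
        apply Continuous.intervalIntegrable
        have := continuous_circleMap a 1
        have h3 : Continuous fun θ => (circleMap a 1 θ - z)⁻¹ := (this.sub continuous_const).inv₀ hne
        have h4 := u.continuous.comp this
        have h5 : Continuous fun θ => deriv (circleMap a 1) θ := by
          simp only [deriv_circleMap]; fun_prop
        exact h5.smul (h3.smul h4))
    rw [circleIntegral, circleIntegral]
    exact hev.symm
  have hun : IsUnit (e - algebraMap ℂ C(X,ℂ) b) := by
    rw [ContinuousMap.isUnit_iff_forall_ne_zero]
    intro x
    simp [e]
  let v : ℂ → C(X, ℂ) := fun w => Ring.inverse (e - algebraMap ℂ C(X,ℂ) w)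
  have hvA : AnalyticAt ℂ v b := by
    obtain ⟨U, hU⟩ := hun
    have h3 : AnalyticAt ℂ (fun w : ℂ => e - algebraMap ℂ C(X,ℂ) w) b :=
      analyticAt_const.sub ((Algebra.linearMap ℂ C(X,ℂ)).toContinuousLinearMap.analyticAt b)
    have h4 := analyticAt_inverse (𝕜 := ℂ) U
    rw [hU] at h4
    exact AnalyticAt.fun_comp (g := Ring.inverse) (f := fun w : ℂ => e - algebraMap ℂ C(X,ℂ) w) h4 h3
  let d : C(X, ℂ) := ⟨fun x => deriv (circleMap b 1) x, by simp only [deriv_circleMap]; fun_prop⟩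
  have hAll : AnalyticAt ℂ (fun q : ℂ × ℂ => (2 * Real.pi * Complex.I : ℂ)⁻¹ • J (d * (v q.2 * u q.1))) (a, b) := by
    have hv2 : AnalyticAt ℂ (fun q : ℂ × ℂ => v q.2) (a, b) := AnalyticAt.fun_comp (g := v) (f := Prod.snd) hvA analyticAt_snd
    have hu2 : AnalyticAt ℂ (fun q : ℂ × ℂ => u q.1) (a, b) := AnalyticAt.fun_comp (g := u) (f := Prod.fst) huA analyticAt_fst
    have h5 := (analyticAt_const (v := d)).fun_mul (hv2.fun_mul hu2)
    exact (analyticAt_const (v := (2 * Real.pi * Complex.I : ℂ)⁻¹)).fun_smul (AnalyticAt.fun_comp (g := J) (f := fun q : ℂ × ℂ => d * (v q.2 * u q.1)) (J.analyticAt _) h5)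
  refine hAll.congr ?_
  have : ∀ᶠ q : ℂ × ℂ in nhds (a, b), q.2 ∈ Metric.ball b 1 :=
    continuous_snd.continuousAt.eventually (Metric.ball_mem_nhds b one_pos)
  filter_upwards [this] with q hq
  obtain ⟨z, w⟩ := q
  have hne : ∀ θ, circleMap b 1 θ - w ≠ 0 := by
    intro θ h
    have := circleMap_mem_sphere b zero_le_one θ
    rw [sub_eq_zero.1 h] at this
    rw [Metric.mem_ball] at hq; rw [Metric.mem_sphere] at this
    linarith
  have hunw : IsUnit (e - algebraMap ℂ C(X,ℂ) w) := by
    rw [ContinuousMap.isUnit_iff_forall_ne_zero]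
    intro x
    exact hne x
  have hvw : ∀ x, v w x = (circleMap b 1 x - w)⁻¹ := by
    intro x
    have h6 := Ring.inverse_mul_cancel _ hunw
    have h7 := congrArg (fun g : C(X,ℂ) => g x) h6
    exact eq_inv_of_mul_eq_one_left h7
  have := ((h2 z).diffContOnCl (s := Metric.ball b 1)).two_pi_i_inv_smul_circleIntegral_sub_inv_smul hq
  show _ = f (z, w)
  rw [← this]
  congr 1
  rw [circleIntegral]
  rw [← hJ]
  · congr 1
    ext x
    show d x * (v w x * u z x) = _
    rw [hvw, hu]
    rfl
  · have := continuous_circleMap b 1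
    have h3 : Continuous fun θ => (circleMap b 1 θ - w)⁻¹ := (this.sub continuous_const).inv₀ hne
    have h5 : Continuous fun θ => deriv (circleMap b 1) θ := by
      simp only [deriv_circleMap]; fun_prop
    have h8 : Continuous fun w => f (z, w) := by fun_prop
    exact h5.smul (h3.smul (h8.comp this))

theorem osgood_limit (f : ℂ × ℂ → ℂ) (fn : ℕ → ℂ × ℂ → ℂ) (hfn : ∀ n, Differentiable ℂ (fn n))
    (hlim : TendstoLocallyUniformly fn f Filter.atTop) (a b : ℂ) : AnalyticAt ℂ f (a, b) := by
  refine osgood f (hlim.continuous (Filter.Frequently.of_forall (fun n => (hfn n).continuous))) ?_ ?_ a b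
  · intro w
    have h := hlim.comp (fun z : ℂ => (z, w)) (by fun_prop)
    have h2 := (tendstoLocallyUniformlyOn_univ.2 h).differentiableOn
      (Filter.Eventually.of_forall (fun n => ((hfn n).comp (by fun_prop : Differentiable ℂ (fun z : ℂ => (z, w)))).differentiableOn)) isOpen_univ
    exact differentiableOn_univ.1 h2
  · intro w
    have h := hlim.comp (fun z : ℂ => (w, z)) (by fun_prop)
    have h2 := (tendstoLocallyUniformlyOn_univ.2 h).differentiableOn
      (Filter.Eventually.of_forall (fun n => ((hfn n).comp (by fun_prop : Differentiable ℂ (fun z : ℂ => (w, z)))).differentiableOn)) isOpen_univ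
    exact differentiableOn_univ.1 h2

/-- Complexification of a real vector. -/
noncomputable def cplx (z : ℝ × ℝ) : ℂ × ℂ := ((z.1 : ℂ), (z.2 : ℂ))

theorem analytic_limit (F : ℝ × ℝ → ℝ × ℝ) (Fn : ℕ → ℂ × ℂ → ℂ × ℂ) (hFn : ∀ n, Differentiable ℂ (Fn n))
    (ε : ℕ → ℝ) (hε : ∀ n, 0 < ε n) (hε2 : ∀ n, ε (n+1) ≤ ε n / 2)
    (hcl : ∀ n : ℕ, ∀ z, ‖z‖ ≤ n → dist (Fn n z) (Fn (n+1) z) ≤ ε n / 2)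
    (hreal : ∀ z, Filter.Tendsto (fun n => Fn n (cplx z)) Filter.atTop (nhds (cplx (F z)))) :
    AnalyticOnNhd ℝ F Set.univ := by
  have hchain : ∀ n k : ℕ, ∀ z, ‖z‖ ≤ n → dist (Fn n z) (Fn (n+k) z) ≤ ε n - ε (n+k) := by
    intro n k z hz
    induction k with
    | zero => simp
    | succ k ih =>
      have h1 := hcl (n+k) z (hz.trans (by push_cast; linarith [Nat.cast_nonneg (α := ℝ) k]))
      have h2 := hε2 (n+k)
      have h3 := dist_triangle (Fn n z) (Fn (n+k) z) (Fn (n+k+1) z)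
      rw [← add_assoc]
      linarith
  have hεpow : ∀ n, ε n ≤ ε 0 * (1/2)^n := by
    intro n
    induction n with
    | zero => simp
    | succ k ih => rw [pow_succ]; linarith [hε2 k]
  have hε0 : Filter.Tendsto ε Filter.atTop (nhds 0) := by
    refine squeeze_zero (fun n => (hε n).le) hεpow ?_
    have := (tendsto_pow_atTop_nhds_zero_of_lt_one (r := (1/2:ℝ)) (by norm_num) (by norm_num)).const_mul (ε 0)
    simpa using this
  have hcau : ∀ z, ∃ l, Filter.Tendsto (fun n => Fn n z) Filter.atTop (nhds l) := by
    intro z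
    obtain ⟨m, hm⟩ := exists_nat_ge ‖z‖
    have : CauchySeq (fun n => Fn (n + m) z) := by
      refine cauchySeq_of_le_tendsto_0' (fun n => ε (n+m)) ?_ (hε0.comp (Filter.tendsto_add_atTop_nat m))
      intro n k hnk
      obtain ⟨j, rfl⟩ := Nat.exists_eq_add_of_le hnk
      have := hchain (n+m) j z (hm.trans (by push_cast; linarith [Nat.cast_nonneg (α := ℝ) n]))
      rw [show n + j + m = n + m + j by ring]
      linarith [hε (n+m+j)]
    obtain ⟨l, hl⟩ := cauchySeq_tendsto_of_complete this
    exact ⟨l, (Filter.tendsto_add_atTop_iff_nat m).1 hl⟩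
  choose Fc hFc using hcau
  have hdist : ∀ (n : ℕ) z, ‖z‖ ≤ n → dist (Fn n z) (Fc z) ≤ ε n := by
    intro n z hz
    have h1 : Filter.Tendsto (fun k => dist (Fn n z) (Fn (k+n) z)) Filter.atTop (nhds (dist (Fn n z) (Fc z))) :=
      tendsto_const_nhds.dist ((Filter.tendsto_add_atTop_iff_nat n).2 (hFc z))
    refine le_of_tendsto' h1 (fun k => ?_)
    rw [add_comm k n]
    linarith [hchain n k z hz, hε (n+k)]
  have hunif : TendstoLocallyUniformly Fn Fc Filter.atTop := by
    rw [Metric.tendstoLocallyUniformly_iff]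
    intro e he x
    refine ⟨Metric.ball x 1, Metric.ball_mem_nhds x one_pos, ?_⟩
    obtain ⟨m, hm⟩ := exists_nat_ge (‖x‖ + 1)
    filter_upwards [hε0.eventually (gt_mem_nhds he), Filter.eventually_ge_atTop m] with n hn hnm y hy
    rw [dist_comm]
    refine lt_of_le_of_lt (hdist n y ?_) hn
    have h1 : ‖y‖ ≤ ‖x‖ + 1 := by
      have := norm_le_norm_add_norm_sub' y x
      rw [← dist_eq_norm] at this
      rw [Metric.mem_ball] at hy
      linarith
    have h2 : (m:ℝ) ≤ n := by exact_mod_cast hnm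
    linarith
  have hFcF : ∀ z, Fc (cplx z) = cplx (F z) := fun z => tendsto_nhds_unique (hFc _) (hreal z)
  intro z _
  have hcp : AnalyticAt ℝ cplx z := by
    have h1 : AnalyticAt ℝ (fun z : ℝ × ℝ => (z.1 : ℂ)) z :=
      AnalyticAt.fun_comp (g := fun x : ℝ => (x:ℂ)) (f := Prod.fst) (Complex.ofRealCLM.analyticAt _) analyticAt_fst
    have h2 : AnalyticAt ℝ (fun z : ℝ × ℝ => (z.2 : ℂ)) z :=
      AnalyticAt.fun_comp (g := fun x : ℝ => (x:ℂ)) (f := Prod.snd) (Complex.ofRealCLM.analyticAt _) analyticAt_snd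
    exact h1.prod h2
  have hF1 : AnalyticAt ℂ (fun q => (Fc q).1) (cplx z) :=
    osgood_limit _ (fun n q => (Fn n q).1) (fun n => (hFn n).fst)
      (uniformContinuous_fst.comp_tendstoLocallyUniformly hunif) _ _
  have hF2 : AnalyticAt ℂ (fun q => (Fc q).2) (cplx z) :=
    osgood_limit _ (fun n q => (Fn n q).2) (fun n => (hFn n).snd)
      (uniformContinuous_snd.comp_tendstoLocallyUniformly hunif) _ _
  have hR1 : AnalyticAt ℝ (fun z => ((Fc (cplx z)).1).re) z :=
    AnalyticAt.fun_comp (g := Complex.re) (Complex.reCLM.analyticAt _)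
      (AnalyticAt.fun_comp (g := fun q => (Fc q).1) (f := cplx) hF1.restrictScalars hcp)
  have hR2 : AnalyticAt ℝ (fun z => ((Fc (cplx z)).2).re) z :=
    AnalyticAt.fun_comp (g := Complex.re) (Complex.reCLM.analyticAt _)
      (AnalyticAt.fun_comp (g := fun q => (Fc q).2) (f := cplx) hF2.restrictScalars hcp)
  have hR := hR1.prod hR2
  have : F = fun z => (((Fc (cplx z)).1).re, ((Fc (cplx z)).2).re) := by
    funext z
    rw [hFcF]
    simp [cplx]
  rw [this]
  exact hR


/-- The circle. -/
abbrev Circ := AddCircle (1:ℝ)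

theorem circ_eq (u v : ℝ) : (u : Circ) = (v : Circ) ↔ ∃ m : ℤ, u = v + m := by
  rw [← sub_eq_zero, ← AddCircle.coe_sub, AddCircle.coe_eq_zero_iff]
  constructor
  · rintro ⟨m, hm⟩; exact ⟨m, by simp at hm; linarith⟩
  · rintro ⟨m, hm⟩; exact ⟨m, by simp [hm]⟩

theorem circ_lift (y : Circ) (s : ℝ) : ∃ t : ℝ, s ≤ t ∧ t < s + 1 ∧ (t : Circ) = y := by
  have h : y ∈ ((↑) : ℝ → AddCircle (1:ℝ)) '' Set.Ico s (s + 1) := by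
    rw [AddCircle.coe_image_Ico_eq]; trivial
  obtain ⟨t, ht, h⟩ := h
  exact ⟨t, ht.1, ht.2, h⟩

theorem circ_dist_le (u v : ℝ) : dist (u : Circ) (v : Circ) ≤ |u - v| := by
  rw [dist_eq_norm, ← AddCircle.coe_sub]
  exact QuotientAddGroup.norm_mk_le_norm

theorem circ_ball (x : Circ) (e : ℝ) (he : 0 ≤ e) : IsConnected (Metric.closedBall x e) := by
  obtain ⟨r, -, -, rfl⟩ := circ_lift x 0
  have h : Metric.closedBall (r : Circ) e = (fun u : ℝ => (u : Circ)) '' (Metric.closedBall r e) := by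
    apply Set.Subset.antisymm
    · intro y hy
      obtain ⟨u, -, -, rfl⟩ := circ_lift y 0
      have h1 : u ∈ (fun u : ℝ => (u : Circ)) ⁻¹' Metric.closedBall (r : Circ) e := hy
      have h2 := AddCircle.coe_real_preimage_closedBall_eq_iUnion (p := (1:ℝ)) r e
      have h3 : u ∈ ⋃ z : ℤ, Metric.closedBall (r + z • (1:ℝ)) e := by rw [← h2]; exact h1
      obtain ⟨z, hz⟩ := Set.mem_iUnion.1 h3
      refine ⟨u - z, ?_, ?_⟩
      · rw [Metric.mem_closedBall, Real.dist_eq] at hz ⊢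
        simp at hz
        rw [show u - z - r = u - (r + z) by ring]; exact hz
      · exact (circ_eq _ _).2 ⟨-z, by push_cast; ring⟩
    · rintro _ ⟨u, hu, rfl⟩
      rw [Metric.mem_closedBall, Real.dist_eq] at *
      exact (circ_dist_le _ _).trans hu
  rw [h]
  refine IsConnected.image ⟨⟨r, by simpa using he⟩, (convex_closedBall r e).isPreconnected⟩ _ ?_
  exact (AddCircle.continuous_mk' 1).continuousOn

theorem nested_connected {X : Type*} [TopologicalSpace X] [T2Space X] (A : ℕ → Set X)
    (hA : ∀ n, A (n+1) ⊆ A n) (hc : ∀ n, IsCompact (A n)) (hcon : ∀ n, IsConnected (A n)) :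
    IsContinuum (⋂ n, A n) := by
  have hanti : Antitone A := antitone_nat_of_succ_le hA
  have hdir : Directed (· ⊇ ·) A := hanti.directed_ge
  have hcl : ∀ n, IsClosed (A n) := fun n => (hc n).isClosed
  have hcomp : IsCompact (⋂ n, A n) := (hc 0).of_isClosed_subset (isClosed_iInter hcl) (Set.iInter_subset _ 0)
  refine ⟨hcomp, ?_, ?_⟩
  · exact IsCompact.nonempty_iInter_of_directed_nonempty_isCompact_isClosed A hdir (fun n => (hcon n).nonempty) hc hcl
  · intro U V hU hV hS hSU hSV
    by_contra hne
    rw [Set.not_nonempty_iff_eq_empty] at hne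
    have h1 : IsCompact ((⋂ n, A n) \ V) := hcomp.diff hV
    have h2 : IsCompact ((⋂ n, A n) \ U) := hcomp.diff hU
    have hd : Disjoint ((⋂ n, A n) \ V) ((⋂ n, A n) \ U) := by
      rw [Set.disjoint_left]
      rintro z ⟨hz, hzV⟩ ⟨_, hzU⟩
      rcases hS hz with h | h
      · exact hzU h
      · exact hzV h
    obtain ⟨U', V', hU', hV', hUs, hVs, hdis⟩ := SeparatedNhds.of_isCompact_isCompact h1 h2 hd
    have hsub : (⋂ n, A n) ⊆ U' ∪ V' := by
      intro z hz
      by_cases hzV : z ∈ V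
      · right; apply hVs; refine ⟨hz, fun hzU => ?_⟩
        have : z ∈ (⋂ n, A n) ∩ (U ∩ V) := ⟨hz, hzU, hzV⟩
        rw [hne] at this; exact this
      · left; exact hUs ⟨hz, hzV⟩
    obtain ⟨n, hn⟩ := exists_subset_nhds_of_isCompact hdir hc (U := U' ∪ V')
      (fun z hz => (hU'.union hV').mem_nhds (hsub hz))
    have hnn : ∀ W : Set X, ((⋂ n, A n) ∩ W).Nonempty → (A n ∩ W).Nonempty := fun W ⟨z, hz, hw⟩ => ⟨z, Set.mem_iInter.1 hz n, hw⟩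
    obtain ⟨u, hu, huU⟩ := hSU
    obtain ⟨v, hv, hvV⟩ := hSV
    have huV : u ∉ V := fun h => by
      have : u ∈ (⋂ n, A n) ∩ (U ∩ V) := ⟨hu, huU, h⟩
      rw [hne] at this; exact this
    have hvU : v ∉ U := fun h => by
      have : v ∈ (⋂ n, A n) ∩ (U ∩ V) := ⟨hv, h, hvV⟩
      rw [hne] at this; exact this
    obtain ⟨w, -, hw1, hw2⟩ := (hcon n).isPreconnected U' V' hU' hV' hn (hnn _ ⟨u, hu, hUs ⟨hu, huV⟩⟩) (hnn _ ⟨v, hv, hVs ⟨hv, hvU⟩⟩)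
    exact Set.disjoint_left.1 hdis hw1 hw2

theorem circ_eq_cases (u v : ℝ) (h : (u : Circ) = v) (h1 : u ≤ v + 1) (h2 : v ≤ u + 1) :
    u = v ∨ u = v + 1 ∨ v = u + 1 := by
  obtain ⟨m, hm⟩ := (circ_eq _ _).1 h
  have a1 : (m:ℝ) ≤ 1 := by linarith
  have a2 : (-1:ℝ) ≤ m := by linarith
  have b1 : m ≤ 1 := by exact_mod_cast a1
  have b2 : -1 ≤ m := by exact_mod_cast a2
  have : m = -1 ∨ m = 0 ∨ m = 1 := by omega
  rcases this with rfl | rfl | rfl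
  · right; right; rw [hm]; push_cast; ring
  · left; rw [hm]; simp
  · right; left; rw [hm]; simp

theorem arc3 (s t t1 s1 s2 t2 : ℝ) (a1 : s ≤ t1) (a2 : t1 < s1) (a3 : s1 ≤ t) (a4 : t ≤ s2) (a5 : s2 < t2)
    (a6 : t2 ≤ s + 1) : ∃ C1 C2 C3 : Set Circ, IsClosed C1 ∧ IsClosed C2 ∧ IsClosed C3 ∧
      (∀ y, y ∈ C1 ∨ y ∈ C2 ∨ y ∈ C3) ∧ (∀ y, y ∈ C1 → y ∈ C3 → False) ∧
      (∀ y, y ∈ C1 → y ∈ C2 → y = t1 ∨ y = t2) ∧ (∀ y, y ∈ C2 → y ∈ C3 → y = s1 ∨ y = s2) ∧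
      (s : Circ) ∈ C1 ∧ (t : Circ) ∈ C3 := by
  have hcl : ∀ a b : ℝ, IsClosed ((fun u : ℝ => (u : Circ)) '' Set.Icc a b) := fun a b =>
    (isCompact_Icc.image (AddCircle.continuous_mk' 1)).isClosed
  refine ⟨(fun u : ℝ => (u : Circ)) '' Set.Icc (t2-1) t1, (fun u : ℝ => (u : Circ)) '' Set.Icc t1 s1 ∪
    (fun u : ℝ => (u : Circ)) '' Set.Icc s2 t2, (fun u : ℝ => (u : Circ)) '' Set.Icc s1 s2, hcl _ _,
    (hcl _ _).union (hcl _ _), hcl _ _, ?_, ?_, ?_, ?_, ⟨s, ⟨by linarith, by linarith⟩, rfl⟩,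
    ⟨t, ⟨by linarith, by linarith⟩, rfl⟩⟩
  · intro y
    obtain ⟨u, h1, h2, rfl⟩ := circ_lift y (t2-1)
    rcases le_total u t1 with h3 | h3
    · left; exact ⟨u, ⟨h1, h3⟩, rfl⟩
    right
    rcases le_total u s1 with h4 | h4
    · left; left; exact ⟨u, ⟨h3, h4⟩, rfl⟩
    rcases le_total u s2 with h5 | h5
    · right; exact ⟨u, ⟨h4, h5⟩, rfl⟩
    · left; right; exact ⟨u, ⟨h5, by linarith⟩, rfl⟩
  · rintro _ ⟨u, ⟨h1, h2⟩, rfl⟩ ⟨v, ⟨h3, h4⟩, h⟩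
    rcases circ_eq_cases v u h (by linarith) (by linarith) with h | h | h <;> linarith
  · rintro _ ⟨u, ⟨h1, h2⟩, rfl⟩ (⟨v, ⟨h3, h4⟩, h⟩ | ⟨v, ⟨h3, h4⟩, h⟩)
    · rcases circ_eq_cases v u h (by linarith) (by linarith) with h | h | h
      · left; beta_reduce; rw [show u = t1 by linarith]
      · linarith
      · linarith
    · rcases circ_eq_cases v u h (by linarith) (by linarith) with h' | h' | h'
      · linarith
      · right; rw [← h]; beta_reduce; rw [show v = t2 by linarith]
      · linarith
  · rintro _ (⟨v, ⟨h3, h4⟩, h⟩ | ⟨v, ⟨h3, h4⟩, h⟩) ⟨u, ⟨h1, h2⟩, rfl⟩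
    · rcases circ_eq_cases v u h (by linarith) (by linarith) with h | h | h
      · left; beta_reduce; rw [show u = s1 by linarith]
      · linarith
      · linarith
    · rcases circ_eq_cases v u h (by linarith) (by linarith) with h | h | h
      · right; beta_reduce; rw [show u = s2 by linarith]
      · linarith
      · linarith

/-- Data for the topological limiting argument. -/
structure TopData (H K h : ℕ → Circ × Circ → Circ × Circ) (ε : ℕ → ℝ) : Prop where
  hH : ∀ n, Continuous (H n)
  hK : ∀ n, Continuous (K n)
  HK : ∀ n z, H n (K n z) = z
  KH : ∀ n z, K n (H n z) = z
  step : ∀ n z, K n z = h n (K (n+1) z)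
  pos : ∀ n, 0 < ε n
  half : ∀ n, ε (n+1) ≤ ε n / 2
  small : ∀ n u v, dist u v ≤ 2 * ε n → dist (H n u) (H n v) ≤ (1/2)^n
  fst : ∀ n u, dist (h n u).1 u.1 ≤ ε n / 2
  uc : ∀ n u v, dist u v ≤ ε (n+1) → dist (h n u) (h n v) ≤ ε n / 2
  crook : ∀ n (x : Circ) (s t : ℝ), s ≤ t → ∃ t' s', s ≤ t' ∧ t' ≤ s' ∧ s' ≤ t ∧
    dist (h n (x, (t':Circ))).2 (h n (x, (t : Circ))).2 ≤ ε n ∧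
    dist (h n (x, (s':Circ))).2 (h n (x, (s : Circ))).2 ≤ ε n

theorem half_tendsto (ε : ℕ → ℝ) (h0 : ∀ n, 0 < ε n) (h : ∀ n, ε (n+1) ≤ ε n / 2) :
    Filter.Tendsto ε Filter.atTop (nhds 0) := by
  have hεpow : ∀ n, ε n ≤ ε 0 * (1/2)^n := by
    intro n
    induction n with
    | zero => simp
    | succ k ih => rw [pow_succ]; linarith [h k]
  refine squeeze_zero (fun n => (h0 n).le) hεpow ?_
  have := (tendsto_pow_atTop_nhds_zero_of_lt_one (r := (1/2:ℝ)) (by norm_num) (by norm_num)).const_mul (ε 0)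
  simpa using this

theorem td_cont {H K h : ℕ → Circ × Circ → Circ × Circ} {ε : ℕ → ℝ} (D : TopData H K h ε)
    {p : Circ × Circ → Circ} (hp : ∀ n z, dist (K n z).1 (p z) ≤ ε n)
    : Continuous p := by
  have h1 : TendstoUniformly (fun n z => (K n z).1) p Filter.atTop := by
    rw [Metric.tendstoUniformly_iff]
    intro e he
    filter_upwards [(half_tendsto ε D.pos D.half).eventually (gt_mem_nhds he)] with n hn z
    rw [dist_comm]; exact (hp n z).trans_lt hn
  exact h1.continuous (Filter.Frequently.of_forall (fun n => continuous_fst.comp (D.hK n)))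

theorem td_fibre {H K h : ℕ → Circ × Circ → Circ × Circ} {ε : ℕ → ℝ} (D : TopData H K h ε)
    {p : Circ × Circ → Circ} (hp : ∀ n z, dist (K n z).1 (p z) ≤ ε n)
    (x : Circ) : p ⁻¹' {x} = ⋂ n, H n '' (Metric.closedBall x (ε n) ×ˢ Set.univ) := by
  ext z
  simp only [Set.mem_preimage, Set.mem_singleton_iff, Set.mem_iInter]
  constructor
  · rintro rfl n
    exact ⟨K n z, ⟨hp n z, trivial⟩, D.HK n z⟩
  · intro hz
    have h2 : ∀ n, dist (p z) x ≤ ε n + ε n := by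
      intro n
      obtain ⟨u, ⟨hu, -⟩, rfl⟩ := hz n
      have h3 := hp n (H n u)
      rw [D.KH] at h3
      rw [Metric.mem_closedBall] at hu
      have := dist_triangle_left (p (H n u)) x u.1
      linarith
    have h4 := half_tendsto ε D.pos D.half
    have h5 := h4.add h4
    rw [add_zero] at h5
    have := ge_of_tendsto' h5 h2
    exact dist_le_zero.1 this

theorem td_continuum {H K h : ℕ → Circ × Circ → Circ × Circ} {ε : ℕ → ℝ} (D : TopData H K h ε)
    {p : Circ × Circ → Circ} (hp : ∀ n z, dist (K n z).1 (p z) ≤ ε n)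
    (x : Circ) : IsContinuum (p ⁻¹' {x}) := by
  rw [td_fibre D hp x]
  apply nested_connected
  · rintro n _ ⟨u, ⟨hu, -⟩, rfl⟩
    refine ⟨K n (H (n+1) u), ⟨?_, trivial⟩, D.HK _ _⟩
    rw [D.step, D.KH]
    rw [Metric.mem_closedBall] at *
    have := dist_triangle (h n u).1 u.1 x
    linarith [D.fst n u, D.half n]
  · intro n
    exact ((isCompact_closedBall _ _).prod isCompact_univ).image (D.hH n)
  · intro n
    exact ((circ_ball x _ (D.pos n).le).prod isConnected_univ).image _ (D.hH n).continuousOn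

theorem td_surj {H K h : ℕ → Circ × Circ → Circ × Circ} {ε : ℕ → ℝ} (D : TopData H K h ε)
    {p : Circ × Circ → Circ} (hp : ∀ n z, dist (K n z).1 (p z) ≤ ε n)
    : Function.Surjective p := by
  intro x
  obtain ⟨z, hz⟩ := (td_continuum D hp x).2.nonempty
  exact ⟨z, hz⟩

theorem td_hered {H K h : ℕ → Circ × Circ → Circ × Circ} {ε : ℕ → ℝ} (D : TopData H K h ε)
    {p : Circ × Circ → Circ} (hp : ∀ n z, dist (K n z).1 (p z) ≤ ε n)
    (x : Circ) (Q : Set (Circ × Circ)) (hQ : Q ⊆ p ⁻¹' {x}) (hQc : IsContinuum Q) :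
    Indecomposable Q := by
  intro A B hA hB hAB
  by_contra hcon
  push Not at hcon
  obtain ⟨hAQ, hBQ⟩ := hcon
  obtain ⟨b, hbQ, hbA⟩ : ∃ b ∈ Q, b ∉ A := by
    by_contra! hh
    exact hAQ (Set.Subset.antisymm (hAB ▸ Set.subset_union_left) hh)
  obtain ⟨a, haQ, haB⟩ : ∃ a ∈ Q, a ∉ B := by
    by_contra! hh
    exact hBQ (Set.Subset.antisymm (hAB ▸ Set.subset_union_right) hh)
  have haA : a ∈ A := by rw [← hAB] at haQ; exact haQ.resolve_right haB
  have hbB : b ∈ B := by rw [← hAB] at hbQ; exact hbQ.resolve_left hbA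
  obtain ⟨δ1, hδ1, hd1⟩ := Metric.isOpen_iff.1 hA.1.isClosed.isOpen_compl b hbA
  obtain ⟨δ2, hδ2, hd2⟩ := Metric.isOpen_iff.1 hB.1.isClosed.isOpen_compl a haB
  obtain ⟨n, hn⟩ := exists_pow_lt_of_lt_one (show 0 < min δ1 δ2 / 2 by positivity) (show (1/2:ℝ) < 1 by norm_num)
  have hn1 : 2 * (1/2:ℝ)^n < δ1 := by linarith [min_le_left δ1 δ2]
  have hn2 : 2 * (1/2:ℝ)^n < δ2 := by linarith [min_le_right δ1 δ2]
  have hnpos : 0 < (1/2:ℝ)^n := by positivity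
  have hpx : ∀ z ∈ Q, ∀ m, dist (K m z).1 x ≤ ε m := by
    intro z hz m
    have h1 := hp m z
    have h2 : p z = x := hQ hz
    rwa [h2] at h1
  -- closeness claim
  have claim : ∀ (c z : Circ × Circ), dist (K (n+1) c).1 x ≤ ε (n+1) → dist (K (n+1) z).1 x ≤ ε (n+1) →
      dist (h n (x, (K (n+1) z).2)).2 (h n (x, (K (n+1) c).2)).2 ≤ ε n → dist z c ≤ (1/2)^n := by
    intro c z hc hz hh
    rw [← D.HK n z, ← D.HK n c]
    apply D.small
    rw [D.step n z, D.step n c]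
    have hcv : ∀ q : Circ × Circ, dist q.1 x ≤ ε (n+1) → dist (h n q).1 x ≤ ε n ∧ dist (h n q).2 (h n (x, q.2)).2 ≤ ε n / 2 := by
      intro q hq
      constructor
      · have := dist_triangle (h n q).1 q.1 x
        linarith [D.fst n q, D.half n]
      · have h1 : dist q (x, q.2) ≤ ε (n+1) := by
          rw [Prod.dist_eq]; simp [hq, (D.pos (n+1)).le]
        have h2 := D.uc n _ _ h1
        rw [Prod.dist_eq] at h2
        exact (le_max_right _ _).trans h2
    obtain ⟨c1, c2⟩ := hcv _ hc
    obtain ⟨z1, z2⟩ := hcv _ hz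
    rw [Prod.dist_eq]
    apply max_le
    · have := dist_triangle_right (h n (K (n+1) z)).1 (h n (K (n+1) c)).1 x
      linarith
    · have h3 := dist_triangle4 (h n (K (n+1) z)).2 (h n (x, (K (n+1) z).2)).2 (h n (x, (K (n+1) c).2)).2 (h n (K (n+1) c)).2
      rw [dist_comm (h n (x, (K (n+1) c).2)).2] at h3
      linarith
  obtain ⟨s, -, -, hs⟩ := circ_lift (K (n+1) a).2 0
  obtain ⟨t, hst, hts, ht⟩ := circ_lift (K (n+1) b).2 s
  obtain ⟨t1, s1, e1, e2, e3, e4, e5⟩ := D.crook n x s t hst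
  obtain ⟨s2, t2, g1, g2, g3, g4, g5⟩ := D.crook n x t (s+1) hts.le
  have hs1 : ((s + 1 : ℝ) : Circ) = s := (circ_eq _ _).2 ⟨1, by simp⟩
  rw [hs1] at g4
  rw [ht] at e4 g5
  rw [hs] at e5 g4
  have near_b : ∀ z, dist (K (n+1) z).1 x ≤ ε (n+1) → ((K (n+1) z).2 = t1 ∨ (K (n+1) z).2 = t2) → dist z b ≤ (1/2)^n := by
    intro z hz h1
    refine claim b z (hpx b hbQ _) hz ?_
    rcases h1 with h1 | h1 <;> rw [h1] <;> assumption
  have near_a : ∀ z, dist (K (n+1) z).1 x ≤ ε (n+1) → ((K (n+1) z).2 = s1 ∨ (K (n+1) z).2 = s2) → dist z a ≤ (1/2)^n := by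
    intro z hz h1
    refine claim a z (hpx a haQ _) hz ?_
    rcases h1 with h1 | h1 <;> rw [h1] <;> assumption
  have hab : ¬ dist b a < δ2 := fun hh => hd2 (Metric.mem_ball.2 hh) hbB
  have nocommon : ∀ r : ℝ, ((r:Circ) = t1 ∨ (r:Circ) = t2) → ((r:Circ) = s1 ∨ (r:Circ) = s2) → False := by
    intro r h1 h2
    have hz : K (n+1) (H (n+1) (x, (r:Circ))) = (x, (r:Circ)) := D.KH _ _
    have h3 := near_b (H (n+1) (x, (r:Circ))) (by rw [hz]; simp [(D.pos (n+1)).le]) (by rw [hz]; exact h1)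
    have h4 := near_a (H (n+1) (x, (r:Circ))) (by rw [hz]; simp [(D.pos (n+1)).le]) (by rw [hz]; exact h2)
    apply hab
    have := dist_triangle_left b a (H (n+1) (x, (r:Circ)))
    linarith
  have e2' : t1 < s1 := lt_of_le_of_ne e2 (fun hh => nocommon t1 (Or.inl rfl) (Or.inl (by rw [hh])))
  have g2' : s2 < t2 := lt_of_le_of_ne g2 (fun hh => nocommon t2 (Or.inr rfl) (Or.inr (by rw [hh])))
  obtain ⟨C1, C2, C3, c1, c2, c3, cov, c13, c12, c23, cs, ct⟩ := arc3 s t t1 s1 s2 t2 e1 e2' e3 g1 g2' g3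
  have hcK : Continuous (fun z => (K (n+1) z).2) := continuous_snd.comp (D.hK _)
  have hAX : ∀ z ∈ A, (K (n+1) z).2 ∈ C1 := by
    by_contra! hh
    obtain ⟨z, hz, hzC⟩ := hh
    obtain ⟨w, hwA, hw1, hw2⟩ := isPreconnected_closed_iff.1 hA.2.isPreconnected _ _ (c1.preimage hcK) ((c2.union c3).preimage hcK)
      (fun z _ => by rcases cov (K (n+1) z).2 with h | h | h
                     · left; exact h
                     · right; left; exact h
                     · right; right; exact h)
      ⟨a, haA, by rw [Set.mem_preimage, ← hs]; exact cs⟩ ⟨z, hz, by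
        rcases cov (K (n+1) z).2 with h | h | h
        · exact absurd h hzC
        · left; exact h
        · right; exact h⟩
    rcases hw2 with hw2 | hw2
    · have h5 := near_b w (hpx w (by rw [← hAB]; exact Or.inl hwA) _) (c12 _ hw1 hw2)
      exact hd1 (Metric.mem_ball.2 (by linarith)) hwA
    · exact c13 _ hw1 hw2
  have hBX : ∀ z ∈ B, (K (n+1) z).2 ∈ C3 := by
    by_contra! hh
    obtain ⟨z, hz, hzC⟩ := hh
    obtain ⟨w, hwB, hw1, hw2⟩ := isPreconnected_closed_iff.1 hB.2.isPreconnected _ _ (c3.preimage hcK) ((c2.union c1).preimage hcK)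
      (fun z _ => by rcases cov (K (n+1) z).2 with h | h | h
                     · right; right; exact h
                     · right; left; exact h
                     · left; exact h)
      ⟨b, hbB, by rw [Set.mem_preimage, ← ht]; exact ct⟩ ⟨z, hz, by
        rcases cov (K (n+1) z).2 with h | h | h
        · right; exact h
        · left; exact h
        · exact absurd h hzC⟩
    rcases hw2 with hw2 | hw2
    · have h5 := near_a w (hpx w (by rw [← hAB]; exact Or.inr hwB) _) (c23 _ hw2 hw1)
      exact hd2 (Metric.mem_ball.2 (by linarith)) hwB
    · exact c13 _ hw2 hw1
  obtain ⟨w, -, hwA, hwB⟩ := isPreconnected_closed_iff.1 hQc.2.isPreconnected A B hA.1.isClosed hB.1.isClosed hAB.ge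
    ⟨a, haQ, haA⟩ ⟨b, hbQ, hbB⟩
  exact c13 _ (hAX w hwA) (hBX w hwB)

theorem td_chain {H K h : ℕ → Circ × Circ → Circ × Circ} {ε : ℕ → ℝ} (D : TopData H K h ε)
    {p : Circ × Circ → Circ} (hp : ∀ n z, dist (K n z).1 (p z) ≤ ε n)
    (x : Circ) (e : ℝ) (he : 0 < e) : ∃ (N : ℕ) (_ : 0 < N) (D : ZMod N → Set (Circ × Circ)),
    (∀ ℓ, (D ℓ).Nonempty ∧ IsCompact (D ℓ) ∧ Metric.diam (D ℓ) < e) ∧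
    (∀ k ℓ : ZMod N, (D k ∩ D ℓ).Nonempty ↔ k - ℓ ∈ ({-1, 0, 1} : Set (ZMod N))) ∧
    p ⁻¹' {x} ⊆ ⋃ ℓ, D ℓ := by
  obtain ⟨n, hn⟩ := exists_pow_lt_of_lt_one he (show (1/2:ℝ) < 1 by norm_num)
  obtain ⟨N0, hN0⟩ := exists_nat_ge (1 / (2 * ε n))
  have hεn := D.pos n
  obtain ⟨N, hNpos, hN⟩ : ∃ N : ℕ, 0 < N ∧ (1:ℝ) / N ≤ 2 * ε n := by
    refine ⟨N0 + 1, by omega, ?_⟩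
    rw [div_le_iff₀ (by positivity)] at *
    push_cast
    nlinarith
  have hNR : (0:ℝ) < N := by exact_mod_cast hNpos
  have : NeZero N := ⟨hNpos.ne'⟩
  let arc : ZMod N → Set Circ := fun ℓ => (fun r : ℝ => ZMod.toAddCircle ℓ + (r : Circ)) '' Set.Icc 0 (1 / (N:ℝ))
  have harc : ∀ ℓ, IsCompact (arc ℓ) := fun ℓ => isCompact_Icc.image (continuous_const.add (AddCircle.continuous_mk' 1))
  have hInteg : ∀ k ℓ : ZMod N, (arc k ∩ arc ℓ).Nonempty ↔ k - ℓ ∈ ({-1, 0, 1} : Set (ZMod N)) := by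
    intro k ℓ
    have hpos : (0:ℝ) ≤ 1 / N := by positivity
    constructor
    · rintro ⟨_, ⟨r, ⟨hr0, hr1⟩, rfl⟩, ⟨r', ⟨hr0', hr1'⟩, hrr⟩⟩
      beta_reduce at hrr
      have h1 : ZMod.toAddCircle (k - ℓ) = ((r' - r : ℝ) : Circ) := by
        rw [map_sub, AddCircle.coe_sub]
        rw [sub_eq_sub_iff_add_eq_add, ← hrr, add_comm]
      obtain ⟨J, hJ⟩ := ZMod.intCast_surjective (k - ℓ)
      rw [← hJ, ZMod.toAddCircle_intCast] at h1
      obtain ⟨m, hm⟩ := (circ_eq _ _).1 h1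
      have h2 : (J:ℝ) - N * m = N * (r' - r) := by field_simp at hm; linarith
      have h3 : (N:ℝ) * (r' - r) ≤ 1 := by
        have : r' - r ≤ 1 / N := by linarith
        calc (N:ℝ) * (r' - r) ≤ N * (1 / N) := by gcongr
          _ = 1 := by field_simp
      have h4 : -1 ≤ (N:ℝ) * (r' - r) := by
        have : -(1 / N) ≤ r' - r := by linarith
        calc (-1 : ℝ) = N * (-(1 / N)) := by field_simp
          _ ≤ _ := by gcongr
      have h5 : J - N * m ≤ 1 := by
        have : ((J - N * m : ℤ) : ℝ) ≤ (1:ℤ) := by push_cast; linarith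
        exact_mod_cast this
      have h6 : -1 ≤ J - N * m := by
        have : ((-1 : ℤ) : ℝ) ≤ ((J - N * m : ℤ) : ℝ) := by push_cast; linarith
        exact_mod_cast this
      have h7 : ((J - N * m : ℤ) : ZMod N) = k - ℓ := by push_cast; simp [hJ]
      rw [← h7]
      have h8 : J - N * m = -1 ∨ J - N * m = 0 ∨ J - N * m = 1 := by omega
      rcases h8 with h8 | h8 | h8 <;> rw [h8] <;> simp
    · have h1N : ZMod.toAddCircle (1 : ZMod N) = ((1 / N : ℝ) : Circ) := by
        have := ZMod.toAddCircle_intCast (N := N) 1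
        simpa using this
      intro hk
      rcases hk with hk | hk | hk
      · refine ⟨ZMod.toAddCircle ℓ, ⟨1 / N, ⟨hpos, le_rfl⟩, ?_⟩, ⟨0, ⟨le_rfl, hpos⟩, by simp⟩⟩
        beta_reduce
        rw [← h1N, ← map_add]
        congr 1
        linear_combination hk
      · have : k = ℓ := sub_eq_zero.1 hk
        subst this
        exact ⟨ZMod.toAddCircle k, ⟨0, ⟨le_rfl, hpos⟩, by simp⟩, ⟨0, ⟨le_rfl, hpos⟩, by simp⟩⟩
      · refine ⟨ZMod.toAddCircle k, ⟨0, ⟨le_rfl, hpos⟩, by simp⟩, ⟨1 / N, ⟨hpos, le_rfl⟩, ?_⟩⟩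
        beta_reduce
        rw [← h1N, ← map_add]
        congr 1
        have hk' : k - ℓ = 1 := hk
        linear_combination -hk'
  refine ⟨N, hNpos, fun ℓ => H n '' (Metric.closedBall x (ε n) ×ˢ arc ℓ), ?_, ?_, ?_⟩
  · intro ℓ
    refine ⟨⟨H n (x, ZMod.toAddCircle ℓ), (x, ZMod.toAddCircle ℓ), ⟨by simp [hεn.le], ⟨0, ⟨le_rfl, by positivity⟩, by simp⟩⟩, rfl⟩,
      ((isCompact_closedBall _ _).prod (harc ℓ)).image (D.hH n), lt_of_le_of_lt ?_ hn⟩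
    apply Metric.diam_le_of_forall_dist_le (by positivity)
    rintro _ ⟨u, ⟨hu1, hu2⟩, rfl⟩ _ ⟨v, ⟨hv1, hv2⟩, rfl⟩
    apply D.small
    rw [Prod.dist_eq]
    apply max_le
    · rw [Metric.mem_closedBall] at hu1 hv1
      have := dist_triangle_right u.1 v.1 x
      linarith
    · obtain ⟨r, ⟨hr0, hr1⟩, hr⟩ := hu2
      obtain ⟨r', ⟨hr0', hr1'⟩, hr'⟩ := hv2
      rw [← hr, ← hr']
      beta_reduce
      rw [dist_add_left]
      refine (circ_dist_le _ _).trans (le_trans ?_ hN)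
      rw [abs_le]; constructor <;> linarith
  · intro k ℓ
    rw [← hInteg]
    constructor
    · rintro ⟨_, ⟨u, ⟨hu1, hu2⟩, rfl⟩, ⟨v, ⟨hv1, hv2⟩, huv⟩⟩
      have : v = u := by rw [← D.KH n v, huv, D.KH]
      subst this
      exact ⟨_, hu2, hv2⟩
    · rintro ⟨y, hy1, hy2⟩
      exact ⟨H n (x, y), ⟨_, ⟨by simp [hεn.le], hy1⟩, rfl⟩, ⟨_, ⟨by simp [hεn.le], hy2⟩, rfl⟩⟩
  · intro z hz
    have h1 : dist (K n z).1 x ≤ ε n := by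
      have := hp n z
      rwa [show p z = x from hz] at this
    obtain ⟨b, -, -, hb⟩ := circ_lift (K n z).2 0
    rw [Set.mem_iUnion]
    refine ⟨((⌊N * b⌋ : ℤ) : ZMod N), K n z, ⟨h1, ⟨b - ⌊N*b⌋ / N, ⟨?_, ?_⟩, ?_⟩⟩, D.HK n z⟩
    · rw [sub_nonneg, div_le_iff₀ hNR, mul_comm]; exact Int.floor_le _
    · rw [sub_le_iff_le_add, ← add_div, le_div_iff₀ hNR, mul_comm]; linarith [Int.lt_floor_add_one (N * b)]
    · beta_reduce
      rw [ZMod.toAddCircle_intCast, ← AddCircle.coe_add, ← hb]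
      congr 1
      ring

theorem td_main {H K h : ℕ → Circ × Circ → Circ × Circ} {ε : ℕ → ℝ} (D : TopData H K h ε)
    {p : Circ × Circ → Circ} (hp : ∀ n z, dist (K n z).1 (p z) ≤ ε n)
    : Continuous p ∧ Function.Surjective p ∧ ∀ x, IsPseudoCircle (p ⁻¹' {x}) :=
  ⟨td_cont D hp, td_surj D hp, fun x => ⟨td_continuum D hp x, td_chain D hp x,
    fun Q hQ hQc _ => td_hered D hp x Q hQ hQc⟩⟩


/-- Integer vector as a real vector. -/
def latv (m : ℤ × ℤ) : ℝ × ℝ := ((m.1 : ℝ), (m.2 : ℝ))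

theorem latv_add (m n : ℤ × ℤ) : latv (m + n) = latv m + latv n := by
  simp [latv]

theorem latv_neg (m : ℤ × ℤ) : latv (-m) = -latv m := by
  simp [latv]

/-- Equivariance under integer translations. -/
def Equi (A : ℝ × ℝ → ℝ × ℝ) : Prop := ∀ z m, A (z + latv m) = A z + latv m

theorem Equi.comp {A B : ℝ × ℝ → ℝ × ℝ} (hA : Equi A) (hB : Equi B) : Equi (fun z => A (B z)) := by
  intro z m; beta_reduce; rw [hB, hA]

theorem proj_eq (a b : ℝ × ℝ) : torusProj a = torusProj b ↔ ∃ m, a = b + latv m := by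
  constructor
  · intro h
    obtain ⟨m, hm⟩ := (circ_eq _ _).1 (congrArg Prod.fst h)
    obtain ⟨n, hn⟩ := (circ_eq _ _).1 (congrArg Prod.snd h)
    exact ⟨(m, n), Prod.ext hm hn⟩
  · rintro ⟨m, rfl⟩
    exact Prod.ext ((circ_eq _ _).2 ⟨m.1, rfl⟩) ((circ_eq _ _).2 ⟨m.2, rfl⟩)

theorem proj_surj : Function.Surjective torusProj := by
  rintro ⟨x, y⟩
  obtain ⟨a, -, -, ha⟩ := circ_lift x 0
  obtain ⟨b, -, -, hb⟩ := circ_lift y 0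
  exact ⟨(a, b), Prod.ext ha hb⟩

theorem proj_quot : IsOpenQuotientMap torusProj := by
  have h : IsOpenQuotientMap (fun x : ℝ => (x : Circ)) := QuotientAddGroup.isOpenQuotientMap_mk
  exact h.prodMap h

theorem proj_dist (a b : ℝ × ℝ) : dist (torusProj a) (torusProj b) ≤ dist a b := by
  rw [Prod.dist_eq, Prod.dist_eq]
  refine max_le_max ?_ ?_
  · rw [Real.dist_eq]; exact circ_dist_le _ _
  · rw [Real.dist_eq]; exact circ_dist_le _ _

theorem proj_add (a b : ℝ × ℝ) : torusProj (a + b) = torusProj a + torusProj b := by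
  simp [torusProj]

/-- The induced map on the torus. -/
noncomputable def desc (A : ℝ × ℝ → ℝ × ℝ) (w : Circ × Circ) : Circ × Circ :=
  torusProj (A (Function.surjInv proj_surj w))

theorem desc_proj {A : ℝ × ℝ → ℝ × ℝ} (hA : Equi A) (z : ℝ × ℝ) : desc A (torusProj z) = torusProj (A z) := by
  rw [desc, proj_eq]
  obtain ⟨m, hm⟩ := (proj_eq _ _).1 (Function.surjInv_eq proj_surj (torusProj z))
  exact ⟨m, by rw [hm, hA]⟩

theorem desc_cont {A : ℝ × ℝ → ℝ × ℝ} (hA : Equi A) (hc : Continuous A) : Continuous (desc A) := by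
  rw [← proj_quot.continuous_comp_iff]
  have : desc A ∘ torusProj = fun z => torusProj (A z) := funext (fun z => desc_proj hA z)
  rw [this]
  exact proj_quot.continuous.comp hc

theorem desc_comp {A B : ℝ × ℝ → ℝ × ℝ} (hA : Equi A) (hB : Equi B) (w : Circ × Circ) :
    desc A (desc B w) = desc (fun z => A (B z)) w := by
  obtain ⟨z, rfl⟩ := proj_surj w
  rw [desc_proj hB, desc_proj hA, desc_proj (hA.comp hB)]

theorem desc_inv {A B : ℝ × ℝ → ℝ × ℝ} (hA : Equi A) (hB : Equi B) (h : ∀ z, A (B z) = z) (w : Circ × Circ) :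
    desc A (desc B w) = w := by
  obtain ⟨z, rfl⟩ := proj_surj w
  rw [desc_proj hB, desc_proj hA, h]

theorem desc_iter {A : ℝ × ℝ → ℝ × ℝ} (hA : Equi A) (n : ℕ) (z : ℝ × ℝ) :
    (desc A)^[n] (torusProj z) = torusProj (A^[n] z) := by
  induction n generalizing z with
  | zero => rfl
  | succ n ih => rw [Function.iterate_succ_apply, Function.iterate_succ_apply, desc_proj hA, ih]

theorem equi_disp {A : ℝ × ℝ → ℝ × ℝ} (hA : Equi A) (hc : Continuous A) :
    ∃ φ : Circ × Circ → ℝ × ℝ, Continuous φ ∧ ∀ z, φ (torusProj z) = A z - z := by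
  have h : ∀ z, (fun w => A (Function.surjInv proj_surj w) - Function.surjInv proj_surj w) (torusProj z) = A z - z := by
    intro z
    obtain ⟨m, hm⟩ := (proj_eq _ _).1 (Function.surjInv_eq proj_surj (torusProj z))
    beta_reduce
    rw [hm, hA]
    abel
  refine ⟨fun w => A (Function.surjInv proj_surj w) - Function.surjInv proj_surj w, ?_, h⟩
  rw [← proj_quot.continuous_comp_iff]
  have : (fun w => A (Function.surjInv proj_surj w) - Function.surjInv proj_surj w) ∘ torusProj = fun z => A z - z := funext h
  rw [this]
  exact hc.sub continuous_id

theorem equi_uc {A : ℝ × ℝ → ℝ × ℝ} (hA : Equi A) (hc : Continuous A) : UniformContinuous A := by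
  obtain ⟨φ, hφ, h⟩ := equi_disp hA hc
  have h1 : UniformContinuous φ := CompactSpace.uniformContinuous_of_continuous hφ
  have h2 : UniformContinuous torusProj := (LipschitzWith.of_dist_le_mul (K := 1) (fun a b => by simpa using proj_dist a b)).uniformContinuous
  have h3 : A = fun z => φ (torusProj z) + z := by funext z; rw [h]; abel
  rw [h3]
  exact (h1.comp h2).add uniformContinuous_id

theorem equi_bdd {A : ℝ × ℝ → ℝ × ℝ} (hA : Equi A) (hc : Continuous A) : ∃ C, ∀ z, ‖A z - z‖ ≤ C := by
  obtain ⟨φ, hφ, h⟩ := equi_disp hA hc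
  obtain ⟨C, hC⟩ := (isCompact_range hφ).isBounded.exists_norm_le
  exact ⟨C, fun z => by rw [← h]; exact hC _ ⟨_, rfl⟩⟩

/-- The lattice of integer vectors. -/
noncomputable def LatZ : AddSubgroup (ℝ × ℝ) := ((Int.castAddHom ℝ).prodMap (Int.castAddHom ℝ)).range

theorem lat_mem (v : ℝ × ℝ) : v ∈ LatZ ↔ ∃ m, latv m = v := by
  rfl

instance : Countable LatZ := by
  have : Function.Surjective (fun m : ℤ × ℤ => (⟨latv m, (lat_mem _).2 ⟨m, rfl⟩⟩ : LatZ)) := by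
    rintro ⟨v, hv⟩
    obtain ⟨m, rfl⟩ := (lat_mem v).1 hv
    exact ⟨m, rfl⟩
  exact this.countable

/-- The unit square. -/
def Qsq : Set (ℝ × ℝ) := Set.Ioc 0 (0+1) ×ˢ Set.Ioc 0 (0+1)

theorem Q_meas : MeasurableSet Qsq := measurableSet_Ioc.prod measurableSet_Ioc

theorem Q_unique (z : ℝ × ℝ) : ∃! g : LatZ, g +ᵥ z ∈ Qsq := by
  have key : ∀ x : ℝ, ∃ m : ℤ, (m:ℝ) + x ∈ Set.Ioc (0:ℝ) (0+1) ∧ ∀ k : ℤ, (k:ℝ) + x ∈ Set.Ioc (0:ℝ) (0+1) → k = m := by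
    intro x
    refine ⟨-⌈x⌉ + 1, ?_, ?_⟩
    · have := Int.le_ceil x
      have := Int.ceil_lt_add_one x
      constructor <;> push_cast <;> linarith
    · rintro k ⟨h1, h2⟩
      have : ⌈x⌉ = -k + 1 := by
        rw [Int.ceil_eq_iff]; push_cast; constructor <;> linarith
      omega
  obtain ⟨m, hm, hm'⟩ := key z.1
  obtain ⟨n, hn, hn'⟩ := key z.2
  refine ⟨⟨latv (m, n), (lat_mem _).2 ⟨_, rfl⟩⟩, ⟨hm, hn⟩, ?_⟩
  rintro ⟨v, hv⟩ hh
  obtain ⟨k, rfl⟩ := (lat_mem v).1 hv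
  have h1 := hm' k.1 hh.1
  have h2 := hn' k.2 hh.2
  ext1
  show latv k = latv (m, n)
  rw [← h1, ← h2]

theorem Q_fund : IsAddFundamentalDomain LatZ Qsq (volume : Measure (ℝ × ℝ)) :=
  IsAddFundamentalDomain.mk' Q_meas.nullMeasurableSet Q_unique

theorem proj_mp : MeasurePreserving torusProj (volume.restrict Qsq) volume := by
  have h := AddCircle.measurePreserving_mk (1:ℝ) 0
  have h2 := h.prod h
  rw [Measure.prod_restrict] at h2
  exact h2

theorem desc_mp {F G : ℝ × ℝ → ℝ × ℝ} (hF : Equi F) (hFc : Continuous F) (hGc : Continuous G)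
    (hFG : ∀ z, F (G z) = z) (hGF : ∀ z, G (F z) = z) (hmp : MeasurePreserving F volume volume) :
    MeasurePreserving (desc F) volume volume := by
  refine ⟨(desc_cont hF hFc).measurable, ?_⟩
  ext S hS
  rw [Measure.map_apply (desc_cont hF hFc).measurable hS]
  have hpm : Measurable torusProj := proj_quot.continuous.measurable
  have hvol : ∀ S : Set (Circ × Circ), MeasurableSet S → volume S = volume (torusProj ⁻¹' S ∩ Qsq) := by
    intro S hS
    rw [← proj_mp.map_eq, Measure.map_apply hpm hS, Measure.restrict_apply (hpm hS)]
  rw [hvol _ ((desc_cont hF hFc).measurable hS), hvol _ hS]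
  have h1 : torusProj ⁻¹' (desc F ⁻¹' S) = F ⁻¹' (torusProj ⁻¹' S) := by
    ext z; simp only [Set.mem_preimage, desc_proj hF]
  have h2 : Qsq = F ⁻¹' (G ⁻¹' Qsq) := by ext z; simp [hGF]
  have hGQ : MeasurableSet (G ⁻¹' Qsq) := hGc.measurable Q_meas
  rw [h1]
  conv_lhs => rw [h2]
  rw [← Set.preimage_inter, hmp.measure_preimage ((hpm hS).inter hGQ).nullMeasurableSet]
  have hG : Equi G := by
    intro z m
    have : F (G (z + latv m)) = F (G z + latv m) := by rw [hF, hFG, hFG]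
    have := congrArg G this
    rwa [hGF, hGF] at this
  have hfund : IsAddFundamentalDomain LatZ (G ⁻¹' Qsq) (volume : Measure (ℝ × ℝ)) := by
    refine IsAddFundamentalDomain.mk' hGQ.nullMeasurableSet (fun z => ?_)
    obtain ⟨g, hg, hg'⟩ := Q_unique (G z)
    have hvadd : ∀ g : LatZ, G (g +ᵥ z) = g +ᵥ G z := by
      rintro ⟨v, hv⟩
      obtain ⟨m, rfl⟩ := (lat_mem v).1 hv
      show G (latv m + z) = latv m + G z
      rw [add_comm, hG, add_comm]
    refine ⟨g, by beta_reduce; rw [Set.mem_preimage, hvadd]; exact hg, fun g2 h2 => hg' g2 ?_⟩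
    beta_reduce at h2; rw [Set.mem_preimage, hvadd] at h2; exact h2
  refine hfund.measure_set_eq Q_fund (hpm hS) ?_
  rintro ⟨v, hv⟩
  obtain ⟨m, rfl⟩ := (lat_mem v).1 hv
  ext z
  show torusProj (latv m + z) ∈ S ↔ torusProj z ∈ S
  rw [show torusProj (latv m + z) = torusProj z from (proj_eq _ _).2 ⟨m, add_comm _ _⟩]

theorem mp_limit_le {F : ℝ × ℝ → ℝ × ℝ} {Fn : ℕ → ℝ × ℝ → ℝ × ℝ}
    (hmp : ∀ n, MeasurePreserving (Fn n) volume volume)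
    (hlim : ∀ z, Filter.Tendsto (fun n => Fn n z) Filter.atTop (nhds (F z))) (hFc : Continuous F)
    (U : Set (ℝ × ℝ)) (hU : IsOpen U) : volume (F ⁻¹' U) ≤ volume U := by
  have h1 : ∀ n, ∫⁻ z, U.indicator 1 (Fn n z) = volume U := by
    intro n
    have : (fun z => U.indicator (1 : ℝ × ℝ → ENNReal) (Fn n z)) = (Fn n ⁻¹' U).indicator 1 := by
      rfl
    rw [this, lintegral_indicator_one ((hmp n).measurable hU.measurableSet)]
    exact (hmp n).measure_preimage hU.measurableSet.nullMeasurableSet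
  have h2 : volume (F ⁻¹' U) = ∫⁻ z, (F ⁻¹' U).indicator 1 z :=
    (lintegral_indicator_one (hFc.measurable hU.measurableSet)).symm
  rw [h2]
  calc ∫⁻ z, (F ⁻¹' U).indicator 1 z ≤ ∫⁻ z, Filter.liminf (fun n => U.indicator (1 : ℝ × ℝ → ENNReal) (Fn n z)) Filter.atTop := by
        apply lintegral_mono
        intro z
        by_cases hz : F z ∈ U
        · have : ∀ᶠ n in Filter.atTop, Fn n z ∈ U := (hlim z).eventually (hU.mem_nhds hz)
          refine (Set.indicator_le_self' (fun _ _ => zero_le) z).trans ?_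
          refine Filter.le_liminf_of_le (by isBoundedDefault) ?_
          filter_upwards [this] with n hn
          simp [hn]
        · simp [hz]
    _ ≤ Filter.liminf (fun n => ∫⁻ z, U.indicator (1 : ℝ × ℝ → ENNReal) (Fn n z)) Filter.atTop :=
        lintegral_liminf_le (fun n => (measurable_one.indicator hU.measurableSet).comp (hmp n).measurable)
    _ = volume U := by simp [h1]

theorem mp_limit {F G : ℝ × ℝ → ℝ × ℝ} {Fn Gn : ℕ → ℝ × ℝ → ℝ × ℝ}
    (hF : ∀ n, MeasurePreserving (Fn n) volume volume) (hG : ∀ n, MeasurePreserving (Gn n) volume volume)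
    (hlF : ∀ z, Filter.Tendsto (fun n => Fn n z) Filter.atTop (nhds (F z)))
    (hlG : ∀ z, Filter.Tendsto (fun n => Gn n z) Filter.atTop (nhds (G z)))
    (hFc : Continuous F) (hGc : Continuous G) (hFG : ∀ z, F (G z) = z) (hGF : ∀ z, G (F z) = z) :
    MeasurePreserving F volume volume := by
  have heq : ∀ U, IsOpen U → volume (F ⁻¹' U) = volume U := by
    intro U hU
    refine le_antisymm (mp_limit_le hF hlF hFc U hU) ?_
    have := mp_limit_le hG hlG hGc (F ⁻¹' U) (hU.preimage hFc)
    have h2 : G ⁻¹' (F ⁻¹' U) = U := by ext z; simp [hFG]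
    rwa [h2] at this
  refine ⟨hFc.measurable, ?_⟩
  let e : Homeomorph (ℝ × ℝ) (ℝ × ℝ) := ⟨⟨F, G, hGF, hFG⟩, hFc, hGc⟩
  have : Measure.OuterRegular (Measure.map F (volume : Measure (ℝ × ℝ))) := Measure.OuterRegular.map e volume
  apply Measure.OuterRegular.ext_isOpen
  intro U hU
  rw [Measure.map_apply hFc.measurable hU.measurableSet, heq U hU]

theorem seq_lim {X : Type*} [MetricSpace X] [CompleteSpace X] (u : ℕ → X) (ε : ℕ → ℝ) (h0 : ∀ n, 0 < ε n)
    (h : ∀ n, ε (n+1) ≤ ε n / 2) (hu : ∀ n, dist (u n) (u (n+1)) ≤ ε n / 2) :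
    ∃ l, (∀ n, dist (u n) l ≤ ε n) ∧ Filter.Tendsto u Filter.atTop (nhds l) := by
  have hchain : ∀ n k, dist (u n) (u (n+k)) ≤ ε n - ε (n+k) := by
    intro n k
    induction k with
    | zero => simp
    | succ k ih =>
      have h3 := dist_triangle (u n) (u (n+k)) (u (n+k+1))
      rw [← add_assoc]
      linarith [h (n+k), hu (n+k)]
  have hc : CauchySeq u := by
    refine cauchySeq_of_le_tendsto_0' ε ?_ (half_tendsto ε h0 h)
    intro n m hnm
    obtain ⟨j, rfl⟩ := Nat.exists_eq_add_of_le hnm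
    linarith [hchain n j, h0 (n+j)]
  obtain ⟨l, hl⟩ := cauchySeq_tendsto_of_complete hc
  refine ⟨l, fun n => ?_, hl⟩
  have h1 : Filter.Tendsto (fun k => dist (u n) (u (k+n))) Filter.atTop (nhds (dist (u n) l)) :=
    tendsto_const_nhds.dist ((Filter.tendsto_add_atTop_iff_nat n).2 hl)
  refine le_of_tendsto' h1 (fun k => ?_)
  rw [add_comm k n]
  linarith [hchain n k, h0 (n+k)]

theorem iter_close {F : ℝ × ℝ → ℝ × ℝ} (hF : UniformContinuous F) (N : ℕ) (e : ℝ) (he : 0 < e) :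
    ∃ η > 0, ∀ F' : ℝ × ℝ → ℝ × ℝ, (∀ z, dist (F' z) (F z) ≤ η) → ∀ k ≤ N, ∀ z, dist (F'^[k] z) (F^[k] z) ≤ e := by
  induction N generalizing e with
  | zero =>
    refine ⟨1, one_pos, fun F' _ k hk z => ?_⟩
    obtain rfl : k = 0 := by omega
    simpa using he.le
  | succ N ih =>
    obtain ⟨δ, hδ, hd⟩ := Metric.uniformContinuous_iff.1 hF (e/2) (by positivity)
    obtain ⟨η, hη, h⟩ := ih (min (δ/2) e) (by positivity)
    refine ⟨min η (e/2), by positivity, fun F' hF' k hk z => ?_⟩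
    have h1 := h F' (fun z => (hF' z).trans (min_le_left _ _))
    rcases Nat.lt_or_ge k (N+1) with hk' | hk'
    · exact (h1 k (by omega) z).trans (min_le_right _ _)
    · obtain rfl : k = N + 1 := by omega
      rw [Function.iterate_succ_apply', Function.iterate_succ_apply']
      have h2 := (h1 N le_rfl z).trans (min_le_left _ _)
      have h3 := hd (show dist (F'^[N] z) (F^[N] z) < δ by linarith)
      have h4 := (hF' (F'^[N] z)).trans (min_le_right _ _)
      have := dist_triangle (F' (F'^[N] z)) (F (F'^[N] z)) (F (F^[N] z))
      linarith

theorem rot_lemma {F : ℝ × ℝ → ℝ × ℝ} {ρ : ℝ × ℝ} (C : ℝ) (hC : ∀ z, ‖F z - z‖ ≤ C)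
    (h : ∀ ε > 0, ∃ N : ℕ, 1 ≤ N ∧ ∀ z, ‖F^[N] z - z - (N:ℝ) • ρ‖ ≤ ε * N) (ε : ℝ) (hε : 0 < ε) :
    ∃ N : ℕ, ∀ n : ℕ, N ≤ n → ∀ z, ‖F^[n] z - z - (n:ℝ) • ρ‖ ≤ ε * n := by
  obtain ⟨N, hN, hh⟩ := h (ε/2) (by positivity)
  have hsub : ∀ (m n : ℕ) z, ‖F^[m+n] z - z - ((m+n : ℕ):ℝ) • ρ‖ ≤ ‖F^[m] (F^[n] z) - F^[n] z - (m:ℝ) • ρ‖ + ‖F^[n] z - z - (n:ℝ) • ρ‖ := by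
    intro m n z
    rw [Function.iterate_add_apply]
    have : F^[m] (F^[n] z) - z - ((m+n : ℕ):ℝ) • ρ = (F^[m] (F^[n] z) - F^[n] z - (m:ℝ) • ρ) + (F^[n] z - z - (n:ℝ) • ρ) := by
      push_cast; rw [add_smul]; abel
    rw [this]
    exact norm_add_le _ _
  have hC0 : 0 ≤ C := (norm_nonneg _).trans (hC 0)
  have hr : ∀ (r : ℕ) z, ‖F^[r] z - z - (r:ℝ) • ρ‖ ≤ r * (C + ‖ρ‖) := by
    intro r
    induction r with
    | zero => intro z; simp
    | succ r ih =>
      intro z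
      have h1 := hsub r 1 z
      have h2 := ih (F^[1] z)
      have h3 : ‖F^[1] z - z - ((1:ℕ):ℝ) • ρ‖ ≤ C + ‖ρ‖ := by
        refine (norm_sub_le _ _).trans ?_
        simpa using hC z
      push_cast at h1 ⊢
      push_cast at h3
      linarith
  have hq : ∀ (q : ℕ) z, ‖F^[N*q] z - z - ((N*q : ℕ):ℝ) • ρ‖ ≤ ε/2 * (N*q) := by
    intro q
    induction q with
    | zero => intro z; simp
    | succ q ih =>
      intro z
      have h1 := hsub (N*q) N z
      have h2 := ih (F^[N] z)
      have h3 := hh z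
      rw [mul_add, mul_one]
      push_cast at *
      linarith
  obtain ⟨N0, hN0⟩ := exists_nat_ge (2 * (N * (C + ‖ρ‖)) / ε)
  refine ⟨N0, fun n hn z => ?_⟩
  have hdiv := Nat.div_add_mod n N
  have hlt : n % N < N := Nat.mod_lt _ (by omega)
  have h1 := hsub (N * (n / N)) (n % N) z
  rw [hdiv] at h1
  have h2 := hq (n / N) (F^[n % N] z)
  have h3 := hr (n % N) z
  have h4 : ((n % N : ℕ) : ℝ) * (C + ‖ρ‖) ≤ N * (C + ‖ρ‖) := by
    have : ((n % N : ℕ) : ℝ) ≤ N := by exact_mod_cast hlt.le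
    have := norm_nonneg ρ
    gcongr
  have h5 : (N:ℝ) * ((n / N : ℕ) : ℝ) ≤ n := by
    have : N * (n / N) ≤ n := Nat.mul_div_le _ _
    exact_mod_cast this
  have h6 : (2 * (N * (C + ‖ρ‖)) / ε) ≤ n := hN0.trans (by exact_mod_cast hn)
  rw [div_le_iff₀ hε] at h6
  have h7 : ε/2 * (N * ((n / N : ℕ) : ℝ)) ≤ ε / 2 * n := by gcongr
  linarith


/-- Rotation vectors allowing arbitrarily steep periodic directions. -/
def GoodRho (ρ : ℝ × ℝ) : Prop := ∀ K : ℕ, ∃ M : ℕ, K ≤ M ∧ 0 < M ∧ ∃ j : ℤ, (M:ℝ) * ρ.1 - ρ.2 = j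

theorem goodRho_zero : GoodRho 0 := fun K => ⟨K+1, by omega, by omega, 0, by simp⟩

set_option maxHeartbeats 2000000 in
theorem rho_lemma (ρ : ℝ × ℝ) (hρ : GoodRho ρ) (ζ η : ℝ) (hζ : 0 < ζ) (hη : 0 < η) :
    ∃ ρ' : ℝ × ℝ, GoodRho ρ' ∧ dist ρ' ρ < ζ ∧ ∃ N : ℕ, ∀ w : ℝ × ℝ, ∃ k ≤ N, ∃ m,
      dist ((k:ℝ) • ρ' + latv m) w ≤ η := by
  obtain ⟨K0, hK0⟩ := exists_nat_ge (2/η)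
  obtain ⟨M, hKM, hM0, j, hj⟩ := hρ K0
  have hM : 2 / η ≤ M := hK0.trans (by exact_mod_cast hKM)
  have hMpos : (0:ℝ) < M := by exact_mod_cast hM0
  have hM1 : (1:ℝ) ≤ M := by exact_mod_cast hM0
  have h1M : 1 / (M:ℝ) ≤ η / 2 := by
    rw [div_le_iff₀ hη] at hM
    rw [div_le_iff₀ hMpos]; linarith
  obtain ⟨q0, hq0⟩ := exists_nat_gt (max (2 * M / ζ) (2 * M / η))
  have hq1 : 2 * M / ζ < q0 := (le_max_left _ _).trans_lt hq0
  have hq2 : 2 * M / η < q0 := (le_max_right _ _).trans_lt hq0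
  obtain ⟨q, hqdef⟩ : ∃ q : ℕ, q = q0 + 1 := ⟨_, rfl⟩
  have hqq : (q:ℝ) = q0 + 1 := by rw [hqdef]; push_cast; ring
  have hqpos : (0:ℝ) < q := by rw [hqq]; positivity
  have hqge1 : (1:ℝ) ≤ q := by rw [hqq]; linarith [Nat.cast_nonneg (α := ℝ) q0]
  have hqζ : 2 * M < ζ * q := by
    rw [div_lt_iff₀ hζ] at hq1; rw [hqq]; nlinarith
  have hqη : 2 * M < η * q := by
    rw [div_lt_iff₀ hη] at hq2; rw [hqq]; nlinarith
  have hQη : 2 * M < η * (q:ℝ)^2 := by nlinarith [mul_pos hη hqpos]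
  have hQpos : (0:ℝ) < (q:ℝ)^2 := by positivity
  obtain ⟨u, hu⟩ : ∃ u : ℤ, u = ⌊ρ.1 * q⌋ := ⟨_, rfl⟩
  have hu1 : (u:ℝ) ≤ ρ.1 * q := by rw [hu]; exact Int.floor_le _
  have hu2 : ρ.1 * q < u + 1 := by rw [hu]; exact Int.lt_floor_add_one _
  obtain ⟨α, hα⟩ : ∃ α : ℝ, α = (u * q + 1) / (q:ℝ)^2 := ⟨_, rfl⟩
  have hαQ : α * (q:ℝ)^2 = u * q + 1 := by rw [hα]; field_simp
  have hdα : |α - ρ.1| * q ≤ 1 := by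
    have : (α - ρ.1) * (q:ℝ)^2 = (u - ρ.1 * q) * q + 1 := by rw [sub_mul, hαQ]; ring
    have h3 : |α - ρ.1| * (q:ℝ)^2 ≤ q := by
      rw [← abs_of_pos hQpos, ← abs_mul, this, abs_le]
      constructor <;> nlinarith
    nlinarith [abs_nonneg (α - ρ.1)]
  have hQρ : (M:ℝ) * α - (M * α - j) = j := by ring
  refine ⟨(α, M * α - j), ?_, ?_, q^2, ?_⟩
  · intro K
    refine ⟨M + K * q^2, ?_, by omega, j + K * (u * q + 1), ?_⟩
    · have : 1 ≤ q^2 := Nat.one_le_pow _ _ (by omega)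
      nlinarith
    · push_cast
      linear_combination (K:ℝ) * hαQ
  · rw [Prod.dist_eq, Real.dist_eq, Real.dist_eq]
    apply max_lt
    · show |α - ρ.1| < ζ
      by_contra hc
      push Not at hc
      nlinarith
    · show |M * α - j - ρ.2| < ζ
      have : M * α - j - ρ.2 = M * (α - ρ.1) := by rw [← hj]; ring
      rw [this, abs_mul, abs_of_pos hMpos]
      by_contra hc
      push Not at hc
      nlinarith
  · intro w
    obtain ⟨i, hi⟩ : ∃ i : ℤ, i = ⌊M * w.1 - w.2⌋ := ⟨_, rfl⟩
    have hi1 : (i:ℝ) ≤ M * w.1 - w.2 := by rw [hi]; exact Int.floor_le _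
    have hi2 : M * w.1 - w.2 < i + 1 := by rw [hi]; exact Int.lt_floor_add_one _
    obtain ⟨x, hx⟩ : ∃ x : ℝ, x = (w.2 + i) / M := ⟨_, rfl⟩
    have hxM : M * x = w.2 + i := by rw [hx]; field_simp
    have hxw : |x - w.1| ≤ η / 2 := by
      refine le_trans ?_ h1M
      rw [le_div_iff₀ hMpos, mul_comm, ← abs_of_pos hMpos, ← abs_mul, abs_le, mul_sub, hxM]
      constructor <;> linarith
    obtain ⟨r, hr⟩ : ∃ r : ℤ, r = ⌊x * (q:ℝ)^2⌋ := ⟨_, rfl⟩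
    have hr1 : (r:ℝ) ≤ x * (q:ℝ)^2 := by rw [hr]; exact Int.floor_le _
    have hr2 : x * (q:ℝ)^2 < r + 1 := by rw [hr]; exact Int.lt_floor_add_one _
    have hrx : |r / (q:ℝ)^2 - x| ≤ 1 / (q:ℝ)^2 := by
      have : r / (q:ℝ)^2 - x = (r - x * (q:ℝ)^2) / (q:ℝ)^2 := by field_simp
      rw [this, abs_div, abs_of_pos hQpos]
      gcongr
      rw [abs_le]; constructor <;> linarith
    have hMQ : (M:ℝ) * (1 / (q:ℝ)^2) ≤ η / 2 := by
      rw [mul_one_div, div_le_iff₀ hQpos]; linarith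
    have h1Q : 1 / (q:ℝ)^2 ≤ η / 2 := by
      have : 0 ≤ 1 / (q:ℝ)^2 := by positivity
      exact (le_mul_of_one_le_left this hM1).trans hMQ
    have hqZ : (0:ℤ) < (q:ℤ)^2 := by exact_mod_cast (pow_pos (by omega) 2 : (0:ℕ) < q^2)
    obtain ⟨k0, hk0⟩ : ∃ k0 : ℤ, k0 = (r * (1 - u * q)) % (q:ℤ)^2 := ⟨_, rfl⟩
    have hk0n : 0 ≤ k0 := by rw [hk0]; exact Int.emod_nonneg _ hqZ.ne'
    have hk0l : k0 < (q:ℤ)^2 := by rw [hk0]; exact Int.emod_lt_of_pos _ hqZ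
    obtain ⟨k, rfl⟩ := Int.eq_ofNat_of_zero_le hk0n
    have hdiv := Int.mul_ediv_add_emod (r * (1 - u * q)) ((q:ℤ)^2)
    rw [← hk0] at hdiv
    set d := r * (1 - u * q) / (q:ℤ)^2
    -- k = r (1-uq) - q^2 d
    have hkα : (k:ℝ) * α = r / (q:ℝ)^2 + ((- r * u^2 - d * (u * q + 1) : ℤ) : ℝ) := by
      have hkR : (k:ℝ) = r * (1 - u * q) - (q:ℝ)^2 * d := by
        have : ((k:ℤ):ℝ) = ((r * (1 - u * q) - (q:ℤ)^2 * d : ℤ) : ℝ) := by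
          congr 1; linarith
        push_cast at this; exact this
      rw [hα, hkR]
      push_cast
      field_simp
      ring
    set e : ℤ := - r * u^2 - d * (u * q + 1) with he
    refine ⟨k, by have : (k:ℤ) < ((q^2 : ℕ):ℤ) := by push_cast; exact hk0l
                  omega, (-e, -(M * e) + k * j - i), ?_⟩
    rw [Prod.dist_eq, Real.dist_eq, Real.dist_eq]
    apply max_le
    · show |(k:ℝ) * α + ((-e : ℤ):ℝ) - w.1| ≤ η
      have : (k:ℝ) * α + ((-e : ℤ):ℝ) - w.1 = (r / (q:ℝ)^2 - x) + (x - w.1) := by rw [hkα]; push_cast; ring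
      rw [this]
      exact (abs_add_le _ _).trans (by linarith)
    · show |(k:ℝ) * (M * α - j) + ((-(M * e) + k * j - i : ℤ):ℝ) - w.2| ≤ η
      have : (k:ℝ) * (M * α - j) + ((-(M * e) + k * j - i : ℤ):ℝ) - w.2 = M * (r / (q:ℝ)^2 - x) := by
        have : (k:ℝ) * (M * α - j) = M * (k * α) - k * j := by ring
        rw [this, hkα]; push_cast; linear_combination hxM
      rw [this, abs_mul, abs_of_pos hMpos]
      have := mul_le_mul_of_nonneg_left hrx hMpos.le
      linarith

/-- The shear along lines of slope `M`. -/
def shr {k : Type*} [Field k] (φ : k → k) (M : k) (z : k × k) : k × k :=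
  (z.1 + φ (M * z.1 - z.2) / M, z.2 + φ (M * z.1 - z.2))

theorem shr_inv {k : Type*} [Field k] (φ ψ : k → k) (M : k) (hM : M ≠ 0) (h : ∀ u, ψ u = - φ u) (z : k × k) :
    shr ψ M (shr φ M z) = z := by
  have h1 : M * (z.1 + φ (M * z.1 - z.2) / M) - (z.2 + φ (M * z.1 - z.2)) = M * z.1 - z.2 := by
    field_simp; ring
  simp only [shr, h1, h]
  ext
  · simp only; field_simp; ring
  · simp

/-- Conjugacy data with entire extensions. -/
structure CData (H K : ℝ × ℝ → ℝ × ℝ) (Hc Kc : ℂ × ℂ → ℂ × ℂ) : Prop where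
  HK : ∀ z, H (K z) = z
  KH : ∀ z, K (H z) = z
  eH : Equi H
  eK : Equi K
  cH : Continuous H
  cK : Continuous K
  mH : MeasurePreserving H volume volume
  mK : MeasurePreserving K volume volume
  dH : Differentiable ℂ Hc
  dK : Differentiable ℂ Kc
  rH : ∀ z, Hc (cplx z) = cplx (H z)
  rK : ∀ z, Kc (cplx z) = cplx (K z)

theorem CData.id : CData (fun z => z) (fun z => z) (fun z => z) (fun z => z) where
  HK _ := rfl
  KH _ := rfl
  eH _ _ := rfl
  eK _ _ := rfl
  cH := continuous_id
  cK := continuous_id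
  mH := MeasurePreserving.id _
  mK := MeasurePreserving.id _
  dH := differentiable_id
  dK := differentiable_id
  rH _ := rfl
  rK _ := rfl

theorem CData.comp {H K h k : ℝ × ℝ → ℝ × ℝ} {Hc Kc hc kc : ℂ × ℂ → ℂ × ℂ} (A : CData H K Hc Kc) (B : CData h k hc kc) :
    CData (fun z => H (h z)) (fun z => k (K z)) (fun z => Hc (hc z)) (fun z => kc (Kc z)) where
  HK z := by rw [B.HK, A.HK]
  KH z := by rw [A.KH, B.KH]
  eH := A.eH.comp B.eH
  eK := B.eK.comp A.eK
  cH := A.cH.comp B.cH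
  cK := B.cK.comp A.cK
  mH := A.mH.comp B.mH
  mK := B.mK.comp A.mK
  dH := A.dH.comp B.dH
  dK := B.dK.comp A.dK
  rH z := by rw [B.rH, A.rH]
  rK z := by rw [A.rK, B.rK]

theorem shr_mp (Φ : ℝ → ℝ) (hΦ : Continuous Φ) (M : ℝ) (hM : M ≠ 0) :
    MeasurePreserving (shr Φ M) volume volume := by
  have hL : MeasurePreserving (fun z : ℝ × ℝ => (z.1, M * z.1 - z.2)) volume volume :=
    (MeasurePreserving.id (volume : Measure ℝ)).skew_product (g := fun x y => M * x - y) (by fun_prop)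
      (Filter.Eventually.of_forall (fun x => (Measure.measurePreserving_sub_left volume (M * x)).map_eq))
  have hS : MeasurePreserving (fun z : ℝ × ℝ => (z.1, z.2 + Φ z.1 / M)) volume volume :=
    (MeasurePreserving.id (volume : Measure ℝ)).skew_product (g := fun x y => y + Φ x / M) (by fun_prop)
      (Filter.Eventually.of_forall (fun x => (measurePreserving_add_right volume (Φ x / M)).map_eq))
  have hsw : MeasurePreserving (Prod.swap : ℝ × ℝ → ℝ × ℝ) volume volume := Measure.measurePreserving_swap
  have h := hL.comp (hsw.comp (hS.comp (hsw.comp hL)))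
  convert h using 1
  funext z
  ext
  · simp [shr]
  · simp [shr]; field_simp; ring

theorem shr_equi (Φ : ℝ → ℝ) (hΦ : ∀ x (j : ℤ), Φ (x + j) = Φ x) (M : ℕ) : Equi (shr Φ (M:ℝ)) := by
  intro z m
  have h1 : (M:ℝ) * (z.1 + m.1) - (z.2 + m.2) = (M * z.1 - z.2) + ((M * m.1 - m.2 : ℤ) : ℝ) := by push_cast; ring
  have h2 : Φ ((M:ℝ) * (z.1 + m.1) - (z.2 + m.2)) = Φ (M * z.1 - z.2) := by rw [h1, hΦ]
  ext
  · simp only [shr, latv, Prod.fst_add, Prod.snd_add, h2]; ring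
  · simp only [shr, latv, Prod.fst_add, Prod.snd_add, h2]; ring

theorem EntPer.neg {Φ : ℝ → ℝ} {Φc : ℂ → ℂ} (h : EntPer Φ Φc) : EntPer (fun u => -Φ u) (fun u => -Φc u) where
  diff := h.diff.neg
  real x := by rw [h.real]; push_cast; rfl
  per z j := by rw [h.per]
  perR x j := by rw [h.perR]
  bdd := by obtain ⟨C, hC⟩ := h.bdd; exact ⟨C, fun x => by rw [abs_neg]; exact hC x⟩
  cont := h.cont.neg

theorem shr_diff (Φ : ℂ → ℂ) (hΦ : Differentiable ℂ Φ) (M : ℂ) : Differentiable ℂ (shr Φ M) := by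
  have h : Differentiable ℂ (fun z : ℂ × ℂ => Φ (M * z.1 - z.2)) := hΦ.comp (by fun_prop)
  have h1 : Differentiable ℂ (fun z : ℂ × ℂ => z.1 + Φ (M * z.1 - z.2) / M) := by
    simp only [div_eq_mul_inv]
    exact differentiable_fst.add (h.mul_const _)
  exact h1.prodMk (differentiable_snd.add h)

theorem shr_cont (Φ : ℝ → ℝ) (hΦ : Continuous Φ) (M : ℝ) : Continuous (shr Φ M) := by
  unfold shr
  fun_prop

theorem shr_cplx {Φ : ℝ → ℝ} {Φc : ℂ → ℂ} (h : EntPer Φ Φc) (M : ℕ) (z : ℝ × ℝ) :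
    shr Φc (M:ℂ) (cplx z) = cplx (shr Φ (M:ℝ) z) := by
  have h1 : Φc ((M:ℂ) * (z.1:ℂ) - (z.2:ℂ)) = (Φ ((M:ℝ) * z.1 - z.2) : ℂ) := by
    rw [← h.real]; push_cast; rfl
  simp only [shr, cplx, h1]
  push_cast; rfl

theorem shr_CData {Φ : ℝ → ℝ} {Φc : ℂ → ℂ} (h : EntPer Φ Φc) (M : ℕ) (hM : 0 < M) :
    CData (shr Φ (M:ℝ)) (shr (fun u => -Φ u) (M:ℝ)) (shr Φc (M:ℂ)) (shr (fun u => -Φc u) (M:ℂ)) where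
  HK z := shr_inv _ _ _ (by positivity) (fun u => by simp) z
  KH z := shr_inv _ _ _ (by positivity) (fun u => by simp) z
  eH := shr_equi _ h.perR M
  eK := shr_equi _ h.neg.perR M
  cH := shr_cont _ h.cont _
  cK := shr_cont _ h.neg.cont _
  mH := shr_mp _ h.cont _ (by positivity)
  mK := shr_mp _ h.neg.cont _ (by positivity)
  dH := shr_diff _ h.diff _
  dK := shr_diff _ h.neg.diff _
  rH := shr_cplx h M
  rK := shr_cplx h.neg M

theorem circ_dist_of (a b e : ℝ) (h : ∃ i : ℤ, |a - b - i| ≤ e) : dist (a : Circ) (b : Circ) ≤ e := by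
  obtain ⟨i, hi⟩ := h
  have h1 : (b : Circ) = ((b + i : ℝ) : Circ) := ((circ_eq _ _).2 ⟨i, rfl⟩).symm
  rw [h1]
  refine (circ_dist_le _ _).trans ?_
  rwa [← sub_sub]

theorem step_shear (ρ : ℝ × ℝ) (hρ : GoodRho ρ) (e : ℝ) (he : 0 < e) :
    ∃ h k hc kc, CData h k hc kc ∧ (∀ w, hc (kc w) = w) ∧ (∀ z, h (z + ρ) = h z + ρ) ∧ (∀ z, h (z + -ρ) = h z + -ρ) ∧
      (∀ z, hc (z + cplx ρ) = hc z + cplx ρ) ∧ (∀ z, hc (z + cplx (-ρ)) = hc z + cplx (-ρ)) ∧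
      (∀ u, dist (desc h u).1 u.1 ≤ e / 2) ∧
      (∀ (x : Circ) (s t : ℝ), s ≤ t → ∃ t' s', s ≤ t' ∧ t' ≤ s' ∧ s' ≤ t ∧
        dist (desc h (x, (t':Circ))).2 (desc h (x, (t : Circ))).2 ≤ e ∧
        dist (desc h (x, (s':Circ))).2 (desc h (x, (s : Circ))).2 ≤ e) := by
  obtain ⟨Φ, Φc, hE, hcr⟩ := exists_crooked e he
  obtain ⟨C, hC⟩ := hE.bdd
  obtain ⟨K0, hK0⟩ := exists_nat_ge (2 * C / e)
  obtain ⟨M, hKM, hM0, j, hj⟩ := hρ K0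
  have hMpos : (0:ℝ) < M := by exact_mod_cast hM0
  have hCM : C / M ≤ e / 2 := by
    have : 2 * C / e ≤ M := hK0.trans (by exact_mod_cast hKM)
    rw [div_le_iff₀ he] at this
    rw [div_le_iff₀ hMpos]; linarith
  have D := shr_CData hE M hM0
  have hjc : (M:ℂ) * (ρ.1:ℂ) - (ρ.2:ℂ) = (j:ℂ) := by exact_mod_cast congrArg (fun x : ℝ => (x:ℂ)) hj
  refine ⟨_, _, _, _, D, ?_, ?_, ?_, ?_, ?_, ?_, ?_⟩
  · exact fun w => shr_inv _ _ _ (by exact_mod_cast hM0.ne') (fun u => by simp) w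
  · intro z
    have h2 : Φ ((M:ℝ) * (z.1 + ρ.1) - (z.2 + ρ.2)) = Φ (M * z.1 - z.2) := by
      rw [← hE.perR (M * z.1 - z.2) j]; congr 1; rw [← hj]; ring
    ext
    · simp only [shr, Prod.fst_add, Prod.snd_add, h2]; ring
    · simp only [shr, Prod.fst_add, Prod.snd_add, h2]; ring
  · intro z
    have h2 : Φ ((M:ℝ) * (z.1 + -ρ.1) - (z.2 + -ρ.2)) = Φ (M * z.1 - z.2) := by
      rw [← hE.perR _ j]; congr 1; rw [← hj]; ring
    ext
    · simp only [shr, Prod.fst_add, Prod.snd_add, Prod.fst_neg, Prod.snd_neg, h2]; ring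
    · simp only [shr, Prod.fst_add, Prod.snd_add, Prod.fst_neg, Prod.snd_neg, h2]; ring
  · intro z
    have h2 : Φc ((M:ℂ) * (z.1 + ρ.1) - (z.2 + ρ.2)) = Φc (M * z.1 - z.2) := by
      rw [← hE.per (M * z.1 - z.2) j]; congr 1; rw [← hjc]; ring
    ext
    · simp only [shr, cplx, Prod.fst_add, Prod.snd_add, h2]; ring
    · simp only [shr, cplx, Prod.fst_add, Prod.snd_add, h2]; ring
  · intro z
    have h2 : Φc ((M:ℂ) * (z.1 + ((-ρ.1 : ℝ):ℂ)) - (z.2 + ((-ρ.2 : ℝ) : ℂ))) = Φc (M * z.1 - z.2) := by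
      rw [← hE.per _ j]; congr 1; rw [← hjc]; push_cast; ring
    ext
    · simp only [shr, cplx, Prod.fst_add, Prod.snd_add, Prod.fst_neg, Prod.snd_neg, h2]; ring
    · simp only [shr, cplx, Prod.fst_add, Prod.snd_add, Prod.fst_neg, Prod.snd_neg, h2]; ring
  · intro u
    obtain ⟨z, rfl⟩ := proj_surj u
    rw [desc_proj D.eH]
    refine (circ_dist_le _ _).trans ?_
    simp only [shr, add_sub_cancel_left]
    rw [abs_div, abs_of_pos hMpos]
    exact le_trans (by gcongr; exact hC _) hCM
  · intro x s t hst
    obtain ⟨a, -, -, rfl⟩ := circ_lift x 0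
    obtain ⟨τ, σ, h1, h2, h3, h4, h5⟩ := hcr (M * a - t) (M * a - s) (by linarith)
    have hval : ∀ y : ℝ, (desc (shr Φ (M:ℝ)) ((a : Circ), (y : Circ))).2 = ((M * a - ((M * a - y) - Φ (M * a - y)) : ℝ) : Circ) := by
      intro y
      have := desc_proj D.eH (a, y)
      rw [show ((a : Circ), (y : Circ)) = torusProj (a, y) from rfl, this]
      show ((y + Φ (M * a - y) : ℝ) : Circ) = _
      congr 1; ring
    refine ⟨M * a - σ, M * a - τ, by linarith, by linarith, by linarith, ?_, ?_⟩
    · rw [hval, hval]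
      apply circ_dist_of
      obtain ⟨i, hi⟩ := h5
      refine ⟨-i, ?_⟩
      rw [← abs_neg]
      convert hi using 2
      push_cast
      rw [show (M:ℝ) * a - (M * a - σ) = σ by ring]
      ring
    · rw [hval, hval]
      apply circ_dist_of
      obtain ⟨i, hi⟩ := h4
      refine ⟨-i, ?_⟩
      rw [← abs_neg]
      convert hi using 2
      push_cast
      rw [show (M:ℝ) * a - (M * a - τ) = τ by ring]
      ring


/-- The conjugated translation. -/
def fof {E : Type*} [Add E] (H K : E → E) (ρ z : E) : E := H (K z + ρ)

theorem fof_iter {H K : ℝ × ℝ → ℝ × ℝ} (hHK : ∀ z, H (K z) = z) (hKH : ∀ z, K (H z) = z) (ρ z : ℝ × ℝ) (k : ℕ) :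
    (fof H K ρ)^[k] z = H (K z + (k:ℝ) • ρ) := by
  induction k generalizing z with
  | zero => simp [hHK]
  | succ k ih =>
    rw [Function.iterate_succ_apply, ih, fof, hKH]
    push_cast
    rw [add_smul, one_smul, add_assoc, add_comm ρ]

theorem fof_inv {E : Type*} [AddGroup E] {H K : E → E} (hHK : ∀ z, H (K z) = z) (hKH : ∀ z, K (H z) = z) (ρ z : E) :
    fof H K ρ (fof H K (-ρ) z) = z := by
  rw [fof, fof, hKH, neg_add_cancel_right, hHK]

theorem fof_inv' {E : Type*} [AddGroup E] {H K : E → E} (hHK : ∀ z, H (K z) = z) (hKH : ∀ z, K (H z) = z) (ρ z : E) :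
    fof H K (-ρ) (fof H K ρ z) = z := by
  rw [fof, fof, hKH, add_neg_cancel_right, hHK]

theorem fof_equi {H K : ℝ × ℝ → ℝ × ℝ} (hH : Equi H) (hK : Equi K) (ρ : ℝ × ℝ) : Equi (fof H K ρ) := by
  intro z m
  rw [fof, fof, hK, add_right_comm, hH]

theorem fof_cont {H K : ℝ × ℝ → ℝ × ℝ} (hH : Continuous H) (hK : Continuous K) (ρ : ℝ × ℝ) : Continuous (fof H K ρ) := by
  unfold fof; fun_prop

theorem fof_mp {H K : ℝ × ℝ → ℝ × ℝ} (hH : MeasurePreserving H volume volume) (hK : MeasurePreserving K volume volume)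
    (ρ : ℝ × ℝ) : MeasurePreserving (fof H K ρ) volume volume :=
  hH.comp ((measurePreserving_add_right volume ρ).comp hK)

theorem fof_diff {H K : ℂ × ℂ → ℂ × ℂ} (hH : Differentiable ℂ H) (hK : Differentiable ℂ K)
    (ρ : ℂ × ℂ) : Differentiable ℂ (fof H K ρ) :=
  hH.comp (hK.add_const ρ)

theorem cplx_add (a b : ℝ × ℝ) : cplx (a + b) = cplx a + cplx b := by
  simp [cplx]

theorem cplx_cont : Continuous cplx := by
  unfold cplx; fun_prop

theorem fof_cplx {H K : ℝ × ℝ → ℝ × ℝ} {Hc Kc : ℂ × ℂ → ℂ × ℂ} (D : CData H K Hc Kc) (ρ z : ℝ × ℝ) :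
    fof Hc Kc (cplx ρ) (cplx z) = cplx (fof H K ρ z) := by
  rw [fof, fof, D.rK, ← cplx_add, D.rH]

/-- A stage of the construction. -/
structure St where
  H : ℝ × ℝ → ℝ × ℝ
  K : ℝ × ℝ → ℝ × ℝ
  Hc : ℂ × ℂ → ℂ × ℂ
  Kc : ℂ × ℂ → ℂ × ℂ
  ρ : ℝ × ℝ
  ε : ℝ
  N : ℕ

/-- The properties of stage `n`. -/
structure Good (n : ℕ) (S : St) : Prop where
  D : CData S.H S.K S.Hc S.Kc
  gr : GoodRho S.ρ
  pos : 0 < S.ε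
  small : ∀ u v, dist u v ≤ 2 * S.ε → dist (desc S.H u) (desc S.H v) ≤ (1/2)^n
  iter : ∀ F' : ℝ × ℝ → ℝ × ℝ, (∀ z, dist (F' z) (fof S.H S.K S.ρ z) ≤ S.ε) →
    ∀ k ≤ S.N, ∀ z, dist (F'^[k] z) ((fof S.H S.K S.ρ)^[k] z) ≤ (1/2)^n
  dens : ∀ z w, ∃ k ≤ S.N, ∃ m, dist ((fof S.H S.K S.ρ)^[k] z + latv m) w ≤ (1/2)^n
  densρ : ∀ w, ∃ k ≤ S.N, ∃ m, dist ((k:ℝ) • S.ρ + latv m) w ≤ (1/2)^n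
  N1 : 1 ≤ S.N
  rot : ∀ z, ‖(fof S.H S.K S.ρ)^[S.N] z - z - (S.N:ℝ) • S.ρ‖ ≤ (1/2)^n * S.N
  epsN : S.ε * S.N ≤ (1/2)^n

/-- The relation between successive stages. -/
structure StRel (n : ℕ) (S S' : St) (h : ℝ × ℝ → ℝ × ℝ) : Prop where
  eh : Equi h
  ch : Continuous h
  step : ∀ z, S.K z = h (S'.K z)
  half : S'.ε ≤ S.ε / 2
  fst : ∀ u, dist (desc h u).1 u.1 ≤ S.ε / 2
  uc : ∀ u v, dist u v ≤ S'.ε → dist (desc h u) (desc h v) ≤ S.ε / 2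
  crook : ∀ (x : Circ) (s t : ℝ), s ≤ t → ∃ t' s', s ≤ t' ∧ t' ≤ s' ∧ s' ≤ t ∧
        dist (desc h (x, (t':Circ))).2 (desc h (x, (t : Circ))).2 ≤ S.ε ∧
        dist (desc h (x, (s':Circ))).2 (desc h (x, (s : Circ))).2 ≤ S.ε
  drho : dist S.ρ S'.ρ ≤ S.ε / 2
  dF : ∀ z, dist (fof S.H S.K S.ρ z) (fof S'.H S'.K S'.ρ z) ≤ S.ε / 2
  dG : ∀ z, dist (fof S.H S.K (-S.ρ) z) (fof S'.H S'.K (-S'.ρ) z) ≤ S.ε / 2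
  dFc : ∀ z : ℂ × ℂ, ‖z‖ ≤ (n:ℝ) → dist (fof S.Hc S.Kc (cplx S.ρ) z) (fof S'.Hc S'.Kc (cplx S'.ρ) z) ≤ S.ε / 2
  dGc : ∀ z : ℂ × ℂ, ‖z‖ ≤ (n:ℝ) → dist (fof S.Hc S.Kc (cplx (-S.ρ)) z) (fof S'.Hc S'.Kc (cplx (-S'.ρ)) z) ≤ S.ε / 2

theorem desc_uc {h : ℝ × ℝ → ℝ × ℝ} (hE : Equi h) (hc : Continuous h) (e : ℝ) (he : 0 < e) :
    ∃ η > 0, ∀ u v, dist u v ≤ η → dist (desc h u) (desc h v) ≤ e := by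
  have := CompactSpace.uniformContinuous_of_continuous (desc_cont hE hc)
  obtain ⟨δ, hδ, h⟩ := Metric.uniformContinuous_iff.1 this e he
  exact ⟨δ/2, by positivity, fun u v huv => (h (by linarith)).le⟩

theorem uc_le {h : ℝ × ℝ → ℝ × ℝ} (hu : UniformContinuous h) (e : ℝ) (he : 0 < e) :
    ∃ η > 0, ∀ u v, dist u v ≤ η → dist (h u) (h v) ≤ e := by
  obtain ⟨δ, hδ, h⟩ := Metric.uniformContinuous_iff.1 hu e he
  exact ⟨δ/2, by positivity, fun u v huv => (h (by linarith)).le⟩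

theorem param_lemma {H K : ℝ × ℝ → ℝ × ℝ} {Hc Kc : ℂ × ℂ → ℂ × ℂ} (D : CData H K Hc Kc) (ρ₀ : ℝ × ℝ) (ζ : ℝ) (hζ : 0 < ζ)
    (R : ℝ) : ∃ δ > 0, ∀ ρ, dist ρ ρ₀ < δ → dist ρ₀ ρ ≤ ζ ∧
      (∀ z, dist (fof H K ρ₀ z) (fof H K ρ z) ≤ ζ) ∧ (∀ z, dist (fof H K (-ρ₀) z) (fof H K (-ρ) z) ≤ ζ) ∧
      (∀ z, ‖z‖ ≤ R → dist (fof Hc Kc (cplx ρ₀) z) (fof Hc Kc (cplx ρ) z) ≤ ζ) ∧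
      (∀ z, ‖z‖ ≤ R → dist (fof Hc Kc (cplx (-ρ₀)) z) (fof Hc Kc (cplx (-ρ)) z) ≤ ζ) := by
  obtain ⟨η, hη, hH⟩ := uc_le (equi_uc D.eH D.cH) ζ hζ
  have key : ∀ φ : (ℝ × ℝ) × (ℂ × ℂ) → ℂ × ℂ, Continuous φ → ∀ᶠ ρ in nhds ρ₀, ∀ z ∈ Metric.closedBall (0 : ℂ × ℂ) R,
      dist (φ (ρ₀, z)) (φ (ρ, z)) < ζ := by
    intro φ hφ
    refine (isCompact_closedBall (0 : ℂ × ℂ) R).eventually_forall_of_forall_eventually (P := fun ρ z => dist (φ (ρ₀, z)) (φ (ρ, z)) < ζ) ?_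
    intro y _
    have hc : Continuous (fun q : (ℝ × ℝ) × (ℂ × ℂ) => dist (φ (ρ₀, q.2)) (φ (q.1, q.2))) := by fun_prop
    exact hc.continuousAt.eventually_lt continuousAt_const (by simpa using hζ)
  have cHc := D.dH.continuous
  have cKc := D.dK.continuous
  have cc := cplx_cont
  have k1 := key (fun q => fof Hc Kc (cplx q.1) q.2) (by unfold fof; fun_prop)
  have k2 := key (fun q => fof Hc Kc (cplx (-q.1)) q.2) (by unfold fof; fun_prop)
  obtain ⟨δ, hδ, hk⟩ := Metric.eventually_nhds_iff.1 (k1.and k2)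
  refine ⟨min δ (min η ζ), by positivity, fun ρ hρ => ?_⟩
  have h1 : dist ρ ρ₀ < δ := hρ.trans_le (min_le_left _ _)
  have h2 : dist ρ ρ₀ < η := hρ.trans_le ((min_le_right _ _).trans (min_le_left _ _))
  have h3 : dist ρ ρ₀ < ζ := hρ.trans_le ((min_le_right _ _).trans (min_le_right _ _))
  obtain ⟨k1, k2⟩ := hk h1
  refine ⟨by rw [dist_comm]; exact h3.le, fun z => hH _ _ ?_, fun z => hH _ _ ?_, fun z hz => (k1 z (by simpa using hz)).le, fun z hz => (k2 z (by simpa using hz)).le⟩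
  · rw [dist_add_left, dist_comm]; exact h2.le
  · rw [dist_add_left, dist_neg_neg, dist_comm]; exact h2.le

theorem finish {H K : ℝ × ℝ → ℝ × ℝ} {Hc Kc : ℂ × ℂ → ℂ × ℂ} (D : CData H K Hc Kc) (ρ₀ : ℝ × ℝ) (hρ₀ : GoodRho ρ₀)
    (δ e₀ : ℝ) (hδ : 0 < δ) (he₀ : 0 < e₀) (n : ℕ) :
    ∃ ρ ε N, dist ρ ρ₀ < δ ∧ ε ≤ e₀ ∧ Good n ⟨H, K, Hc, Kc, ρ, ε, N⟩ := by
  have hp : (0:ℝ) < (1/2)^n := by positivity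
  obtain ⟨η, hη, hH⟩ := uc_le (equi_uc D.eH D.cH) _ hp
  obtain ⟨ρ, hρ, hd, N0, hN0⟩ := rho_lemma ρ₀ hρ₀ δ (min η ((1/2)^n)) hδ (by positivity)
  obtain ⟨C1, hC1⟩ := equi_bdd D.eH D.cH
  obtain ⟨C2, hC2⟩ := equi_bdd D.eK D.cK
  obtain ⟨N1, hN1⟩ := exists_nat_ge ((C1 + C2) / (1/2)^n)
  obtain ⟨N, hN⟩ : ∃ N, N = N0 + N1 + 1 := ⟨_, rfl⟩
  have hNpos : (0:ℝ) < N := by rw [hN]; positivity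
  obtain ⟨e1, he1, hs⟩ := desc_uc D.eH D.cH _ hp
  obtain ⟨e2, he2, hi⟩ := iter_close (equi_uc (fof_equi D.eH D.eK ρ) (fof_cont D.cH D.cK ρ)) N _ hp
  obtain ⟨ε, hε⟩ : ∃ ε, ε = min (min e₀ (e1/2)) (min e2 ((1/2)^n / N)) := ⟨_, rfl⟩
  have l1 : ε ≤ e₀ := by rw [hε]; exact (min_le_left _ _).trans (min_le_left _ _)
  have l2 : ε ≤ e1/2 := by rw [hε]; exact (min_le_left _ _).trans (min_le_right _ _)
  have l3 : ε ≤ e2 := by rw [hε]; exact (min_le_right _ _).trans (min_le_left _ _)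
  have l4 : ε ≤ (1/2)^n / N := by rw [hε]; exact (min_le_right _ _).trans (min_le_right _ _)
  refine ⟨ρ, ε, N, hd, l1, ?_⟩
  constructor
  · exact D
  · exact hρ
  · show 0 < ε
    rw [hε]; positivity
  · intro u v huv
    exact hs u v (by dsimp only at huv; linarith)
  · intro F' hF'
    exact hi F' (fun z => (hF' z).trans l3)
  · intro z w
    obtain ⟨k, hk, m, hm⟩ := hN0 (K w - K z)
    refine ⟨k, by dsimp only; omega, m, ?_⟩
    dsimp only
    rw [fof_iter D.HK D.KH, ← D.eH]
    conv_lhs => rw [← D.HK w]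
    apply hH
    refine le_trans (le_of_eq ?_) (hm.trans (min_le_left _ _))
    rw [dist_eq_norm, dist_eq_norm]
    congr 1; abel
  · intro w
    obtain ⟨k, hk, m, hm⟩ := hN0 w
    exact ⟨k, by dsimp only; omega, m, hm.trans (min_le_right _ _)⟩
  · dsimp only; omega
  · intro z
    dsimp only
    rw [fof_iter D.HK D.KH]
    have : H (K z + (N:ℝ) • ρ) - z - (N:ℝ) • ρ = (H (K z + (N:ℝ) • ρ) - (K z + (N:ℝ) • ρ)) + (K z - z) := by abel
    rw [this]
    refine (norm_add_le _ _).trans ((add_le_add (hC1 _) (hC2 _)).trans ?_)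
    rw [div_le_iff₀ hp] at hN1
    refine hN1.trans ?_
    rw [mul_comm]
    gcongr
    omega
  · dsimp only
    rwa [le_div_iff₀ hNpos] at l4

theorem step_exists (n : ℕ) (S : St) (hS : Good n S) : ∃ S' h, Good (n+1) S' ∧ StRel n S S' h := by
  obtain ⟨h, k, hc, kc, D', hck, hρ, hρ', hcρ, hcρ', hfst, hcr⟩ := step_shear S.ρ hS.gr S.ε hS.pos
  have D := hS.D.comp D'
  have hpos := hS.pos
  obtain ⟨δ, hδ, hpar⟩ := param_lemma D S.ρ (S.ε/2) (by positivity) n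
  obtain ⟨η, hη, huc⟩ := desc_uc D'.eH D'.cH (S.ε/2) (by positivity)
  obtain ⟨ρ, ε, N, hd, hεle, hG⟩ := finish D S.ρ hS.gr δ (min (S.ε/2) η) hδ (by positivity) (n+1)
  obtain ⟨p1, p2, p3, p4, p5⟩ := hpar ρ hd
  refine ⟨_, h, hG, ?_⟩
  constructor
  · exact D'.eH
  · exact D'.cH
  · exact fun z => (D'.HK _).symm
  · exact hεle.trans (min_le_left _ _)
  · exact hfst
  · intro u v huv
    exact huc u v (huv.trans (hεle.trans (min_le_right _ _)))
  · exact hcr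
  · exact p1
  · intro z
    have : fof S.H S.K S.ρ z = fof (fun z => S.H (h z)) (fun z => k (S.K z)) S.ρ z := by
      simp only [fof]; rw [hρ, D'.HK]
    rw [this]; exact p2 z
  · intro z
    have : fof S.H S.K (-S.ρ) z = fof (fun z => S.H (h z)) (fun z => k (S.K z)) (-S.ρ) z := by
      simp only [fof]; rw [hρ', D'.HK]
    rw [this]; exact p3 z
  · intro z hz
    have : fof S.Hc S.Kc (cplx S.ρ) z = fof (fun z => S.Hc (hc z)) (fun z => kc (S.Kc z)) (cplx S.ρ) z := by
      simp only [fof]; rw [hcρ, hck]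
    rw [this]; exact p4 z hz
  · intro z hz
    have : fof S.Hc S.Kc (cplx (-S.ρ)) z = fof (fun z => S.Hc (hc z)) (fun z => kc (S.Kc z)) (cplx (-S.ρ)) z := by
      simp only [fof]; rw [hcρ', hck]
    rw [this]; exact p5 z hz

theorem seq_exists : ∃ (S : ℕ → St) (h : ℕ → ℝ × ℝ → ℝ × ℝ), ∀ n, Good n (S n) ∧ StRel n (S n) (S (n+1)) (h n) := by
  obtain ⟨ρ, ε, N, -, -, h0⟩ := finish CData.id 0 goodRho_zero 1 1 one_pos one_pos 0
  choose! nxt hh hg hr using step_exists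
  let S : ℕ → St := fun n => Nat.rec ⟨fun z => z, fun z => z, fun z => z, fun z => z, ρ, ε, N⟩ (fun n s => nxt n s) n
  have hS : ∀ n, Good n (S n) := by
    intro n
    induction n with
    | zero => exact h0
    | succ n ih => exact hg n _ ih
  exact ⟨S, fun n => hh n (S n), fun n => ⟨hS n, hr n _ (hS n)⟩⟩


theorem irr_lemma (ρ : ℝ × ℝ) (h : ∀ η > 0, ∀ w, ∃ (k : ℕ) (m : ℤ × ℤ), dist ((k:ℝ) • ρ + latv m) w ≤ η) :
    LinearIndependent ℚ ![(1:ℝ), ρ.1, ρ.2] := by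
  rw [← LinearIndependent.iff_fractionRing ℤ ℚ, Fintype.linearIndependent_iff]
  intro g hg
  simp only [Fin.sum_univ_three, Matrix.cons_val_zero, Matrix.cons_val_one, Matrix.cons_val, zsmul_eq_mul, mul_one] at hg
  have hbc : g 1 = 0 ∧ g 2 = 0 := by
    by_contra hne
    have hpos : (0:ℝ) < (g 1:ℝ)^2 + (g 2:ℝ)^2 := by
      by_contra hc
      apply hne
      constructor
      · have : (g 1:ℝ) = 0 := by nlinarith [sq_nonneg (g 1 : ℝ), sq_nonneg (g 2 : ℝ)]
        exact_mod_cast this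
      · have : (g 2:ℝ) = 0 := by nlinarith [sq_nonneg (g 1 : ℝ), sq_nonneg (g 2 : ℝ)]
        exact_mod_cast this
    obtain ⟨q, hq⟩ : ∃ q, q = (g 1:ℝ)^2 + (g 2:ℝ)^2 := ⟨_, rfl⟩
    rw [← hq] at hpos
    obtain ⟨L, hL⟩ : ∃ L, L = |(g 1:ℝ)| + |(g 2:ℝ)| + 1 := ⟨_, rfl⟩
    have hLpos : 0 < L := by rw [hL]; positivity
    obtain ⟨k, m, hkm⟩ := h (1/(4*L)) (by positivity) (g 1 / (2 * q), g 2 / (2 * q))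
    rw [Prod.dist_eq, max_le_iff, Real.dist_eq, Real.dist_eq] at hkm
    obtain ⟨h1, h2⟩ := hkm
    change |(k:ℝ) * ρ.1 + m.1 - g 1 / (2*q)| ≤ _ at h1
    change |(k:ℝ) * ρ.2 + m.2 - g 2 / (2*q)| ≤ _ at h2
    have hid : (g 1:ℝ) * ((k:ℝ) * ρ.1 + m.1 - g 1 / (2*q)) + g 2 * ((k:ℝ) * ρ.2 + m.2 - g 2 / (2*q)) =
        ((- k * g 0 + g 1 * m.1 + g 2 * m.2 : ℤ) : ℝ) - 1/2 := by
      have : (g 1:ℝ) * (g 1 / (2*q)) + g 2 * (g 2 / (2*q)) = 1/2 := by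
        field_simp; exact hq.symm
      push_cast
      linear_combination (k:ℝ) * hg - this
    have hle : |((- k * g 0 + g 1 * m.1 + g 2 * m.2 : ℤ) : ℝ) - 1/2| ≤ 1/4 := by
      rw [← hid]
      refine (abs_add_le _ _).trans ?_
      rw [abs_mul, abs_mul]
      have e1 := mul_le_mul_of_nonneg_left h1 (abs_nonneg (g 1 : ℝ))
      have e2 := mul_le_mul_of_nonneg_left h2 (abs_nonneg (g 2 : ℝ))
      have e3 : (|(g 1:ℝ)| + |(g 2:ℝ)| + 1) * (1/(4*L)) = 1/4 := by rw [← hL]; field_simp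
      have e4 : 0 < 1/(4*L) := by positivity
      nlinarith
    generalize (- k * g 0 + g 1 * m.1 + g 2 * m.2 : ℤ) = i at hle
    rw [abs_le] at hle
    have i1 : (0:ℝ) < i := by linarith
    have i2 : (i:ℝ) < 1 := by linarith
    have i1' : 0 < i := by exact_mod_cast i1
    have i2' : i < 1 := by exact_mod_cast i2
    omega
  obtain ⟨hb, hc⟩ := hbc
  rw [hb, hc] at hg
  have ha : g 0 = 0 := by
    have : (g 0 : ℝ) = 0 := by simpa using hg
    exact_mod_cast this
  intro i
  fin_cases i
  · exact ha
  · exact hb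
  · exact hc

theorem lim_cont {X Y : Type*} [MetricSpace X] [MetricSpace Y] {F : X → Y} {Fn : ℕ → X → Y} {ε : ℕ → ℝ}
    (hε : Filter.Tendsto ε Filter.atTop (nhds 0)) (hc : ∀ n, Continuous (Fn n)) (h : ∀ n z, dist (Fn n z) (F z) ≤ ε n) :
    Continuous F := by
  have : TendstoUniformly Fn F Filter.atTop := by
    rw [Metric.tendstoUniformly_iff]
    intro e he
    filter_upwards [hε.eventually_lt_const he] with n hn z
    rw [dist_comm]; exact (h n z).trans_lt hn
  exact this.continuous (Filter.Frequently.of_forall hc)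

theorem lim_inv {X : Type*} [MetricSpace X] {F G : X → X} {Fn Gn : ℕ → X → X} {ε : ℕ → ℝ}
    (hε : Filter.Tendsto ε Filter.atTop (nhds 0)) (hF : Continuous F)
    (h : ∀ n z, dist (Fn n z) (F z) ≤ ε n)
    (hG : ∀ z, Filter.Tendsto (fun n => Gn n z) Filter.atTop (nhds (G z)))
    (hinv : ∀ n z, Fn n (Gn n z) = z) (z : X) : F (G z) = z := by
  have h1 : Filter.Tendsto (fun n => F (Gn n z)) Filter.atTop (nhds (F (G z))) := (hF.tendsto _).comp (hG z)
  have h2 : Filter.Tendsto (fun n => F (Gn n z)) Filter.atTop (nhds z) := by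
    rw [tendsto_iff_dist_tendsto_zero]
    refine squeeze_zero (fun _ => dist_nonneg) (fun n => ?_) hε
    have := h n (Gn n z)
    rw [hinv, dist_comm] at this
    exact this
  exact tendsto_nhds_unique h1 h2

theorem exists_pseudocircle_decomposition :
    ∃ (F : ℝ × ℝ → ℝ × ℝ) (ρ : ℝ × ℝ)
      (p : AddCircle (1:ℝ) × AddCircle (1:ℝ) → AddCircle (1:ℝ))
      (f g : AddCircle (1:ℝ) × AddCircle (1:ℝ) → AddCircle (1:ℝ) × AddCircle (1:ℝ)),
      -- (a) F is real-analytic, bijective with real-analytic inverse,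
      -- commutes with integer translations, and preserves Lebesgue measure
      AnalyticOnNhd ℝ F Set.univ ∧
      (∃ G : ℝ × ℝ → ℝ × ℝ, AnalyticOnNhd ℝ G Set.univ ∧
        Function.LeftInverse G F ∧ Function.RightInverse G F) ∧
      (∀ (z : ℝ × ℝ) (m : ℤ × ℤ),
        F (z + ((m.1 : ℝ), (m.2 : ℝ))) = F z + ((m.1 : ℝ), (m.2 : ℝ))) ∧
      MeasurePreserving F volume volume ∧
      -- F descends to a volume-preserving homeomorphism f of the torus, with inverse g
      (∀ z : ℝ × ℝ, f (torusProj z) = torusProj (F z)) ∧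
      Continuous f ∧ Continuous g ∧
      Function.LeftInverse g f ∧ Function.RightInverse g f ∧
      MeasurePreserving f volume volume ∧
      -- (b) ρ is totally irrational and is the uniform rotation vector of F
      LinearIndependent ℚ ![(1 : ℝ), ρ.1, ρ.2] ∧
      (∀ ε : ℝ, 0 < ε → ∃ N : ℕ, ∀ n : ℕ, N ≤ n → ∀ z : ℝ × ℝ,
        ‖F^[n] z - z - (n : ℝ) • ρ‖ ≤ ε * n) ∧
      -- (c) f is minimal: every full orbit is dense
      (∀ z : AddCircle (1:ℝ) × AddCircle (1:ℝ),
        Dense {w | ∃ n : ℕ, f^[n] z = w ∨ g^[n] z = w}) ∧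
      -- (d) p is a continuous surjection semi-conjugating f to the rotation by ρ₁
      Continuous p ∧ Function.Surjective p ∧
      (∀ z, p (f z) = p z + ((ρ.1 : ℝ) : AddCircle (1:ℝ))) ∧
      -- (e) every fibre of p is a pseudo-circle, and f permutes the fibres
      (∀ x : AddCircle (1:ℝ), IsPseudoCircle (p ⁻¹' {x})) ∧
      (∀ x : AddCircle (1:ℝ),
        f '' (p ⁻¹' {x}) = p ⁻¹' {x + ((ρ.1 : ℝ) : AddCircle (1:ℝ))}) := by
  obtain ⟨S, h, hSR⟩ := seq_exists
  have hS : ∀ n, Good n (S n) := fun n => (hSR n).1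
  have hR : ∀ n, StRel n (S n) (S (n+1)) (h n) := fun n => (hSR n).2
  have D : ∀ n, CData (S n).H (S n).K (S n).Hc (S n).Kc := fun n => (hS n).D
  obtain ⟨ε, hεdef⟩ : ∃ ε : ℕ → ℝ, ε = fun n => (S n).ε := ⟨_, rfl⟩
  have hεn : ∀ n, (S n).ε = ε n := fun n => by rw [hεdef]
  have hpos : ∀ n, 0 < ε n := fun n => by rw [← hεn]; exact (hS n).pos
  have hhalf : ∀ n, ε (n+1) ≤ ε n / 2 := fun n => by rw [← hεn, ← hεn]; exact (hR n).half
  have hε0 := half_tendsto ε hpos hhalf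
  obtain ⟨Fn, hFn⟩ : ∃ Fn : ℕ → ℝ × ℝ → ℝ × ℝ, Fn = fun n => fof (S n).H (S n).K (S n).ρ := ⟨_, rfl⟩
  obtain ⟨Gn, hGn⟩ : ∃ Gn : ℕ → ℝ × ℝ → ℝ × ℝ, Gn = fun n => fof (S n).H (S n).K (-(S n).ρ) := ⟨_, rfl⟩
  have hFn' : ∀ n, fof (S n).H (S n).K (S n).ρ = Fn n := fun n => by rw [hFn]
  have hGn' : ∀ n, fof (S n).H (S n).K (-(S n).ρ) = Gn n := fun n => by rw [hGn]
  -- limits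
  have hFl : ∀ z, ∃ l, (∀ n, dist (Fn n z) l ≤ ε n) ∧ Filter.Tendsto (fun n => Fn n z) Filter.atTop (nhds l) := by
    intro z
    refine seq_lim (fun n => Fn n z) ε hpos hhalf (fun n => ?_)
    have := (hR n).dF z
    rwa [hFn', hFn', hεn] at this
  have hGl : ∀ z, ∃ l, (∀ n, dist (Gn n z) l ≤ ε n) ∧ Filter.Tendsto (fun n => Gn n z) Filter.atTop (nhds l) := by
    intro z
    refine seq_lim (fun n => Gn n z) ε hpos hhalf (fun n => ?_)
    have := (hR n).dG z
    rwa [hGn', hGn', hεn] at this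
  choose F hFd hFt using hFl
  choose G hGd hGt using hGl
  obtain ⟨ρ, hρd, hρt⟩ := seq_lim (fun n => (S n).ρ) ε hpos hhalf (fun n => by
    have := (hR n).drho
    rwa [hεn] at this)
  have hpl : ∀ z : Circ × Circ, ∃ l, (∀ n, dist (desc (S n).K z).1 l ≤ ε n) ∧
      Filter.Tendsto (fun n => (desc (S n).K z).1) Filter.atTop (nhds l) := by
    intro z
    refine seq_lim (fun n => (desc (S n).K z).1) ε hpos hhalf (fun n => ?_)
    have := (hR n).fst (desc (S (n+1)).K z)
    rw [desc_comp (hR n).eh (D (n+1)).eK, hεn] at this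
    rwa [← funext (hR n).step] at this
  choose p hpd hpt using hpl
  -- topological part
  have T : TopData (fun n => desc (S n).H) (fun n => desc (S n).K) (fun n => desc (h n)) ε := by
    constructor
    · exact fun n => desc_cont (D n).eH (D n).cH
    · exact fun n => desc_cont (D n).eK (D n).cK
    · exact fun n z => desc_inv (D n).eH (D n).eK (D n).HK z
    · exact fun n z => desc_inv (D n).eK (D n).eH (D n).KH z
    · intro n z
      beta_reduce
      rw [desc_comp (hR n).eh (D (n+1)).eK, ← funext (hR n).step]
    · exact hpos
    · exact hhalf
    · intro n u v huv
      exact (hS n).small u v (by rw [hεn]; exact huv)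
    · intro n u
      rw [← hεn]; exact (hR n).fst u
    · intro n u v huv
      rw [← hεn]; exact (hR n).uc u v (by rw [hεn]; exact huv)
    · intro n
      rw [← hεn]; exact (hR n).crook
  obtain ⟨hpc, hps, hpp⟩ := td_main T (p := p) (fun n z => hpd z n)
  -- properties of F, G
  have hFnE : ∀ n, Equi (Fn n) := fun n => by rw [← hFn']; exact fof_equi (D n).eH (D n).eK _
  have hGnE : ∀ n, Equi (Gn n) := fun n => by rw [← hGn']; exact fof_equi (D n).eH (D n).eK _
  have hFnC : ∀ n, Continuous (Fn n) := fun n => by rw [← hFn']; exact fof_cont (D n).cH (D n).cK _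
  have hGnC : ∀ n, Continuous (Gn n) := fun n => by rw [← hGn']; exact fof_cont (D n).cH (D n).cK _
  have hFc : Continuous F := lim_cont hε0 hFnC (fun n z => hFd z n)
  have hGc : Continuous G := lim_cont hε0 hGnC (fun n z => hGd z n)
  have hFG : ∀ z, F (G z) = z := lim_inv hε0 hFc (fun n z => hFd z n) hGt
    (fun n z => by rw [← hFn', ← hGn']; exact fof_inv (D n).HK (D n).KH _ z)
  have hGF : ∀ z, G (F z) = z := lim_inv hε0 hGc (fun n z => hGd z n) hFt
    (fun n z => by rw [← hFn', ← hGn']; exact fof_inv' (D n).HK (D n).KH _ z)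
  have hFE : Equi F := by
    intro z m
    refine tendsto_nhds_unique (hFt _) ?_
    simp only [fun n => hFnE n z m]
    exact (hFt z).add_const _
  have hGE : Equi G := by
    intro z m
    refine tendsto_nhds_unique (hGt _) ?_
    simp only [fun n => hGnE n z m]
    exact (hGt z).add_const _
  have hmp : MeasurePreserving F volume volume :=
    mp_limit (fun n => by rw [← hFn']; exact fof_mp (D n).mH (D n).mK _)
      (fun n => by rw [← hGn']; exact fof_mp (D n).mH (D n).mK _) hFt hGt hFc hGc hFG hGF
  have hFa : AnalyticOnNhd ℝ F Set.univ := by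
    refine analytic_limit F (fun n => fof (S n).Hc (S n).Kc (cplx (S n).ρ)) (fun n => fof_diff (D n).dH (D n).dK _)
      ε hpos hhalf (fun n z hz => ?_) (fun z => ?_)
    · have := (hR n).dFc z hz
      rwa [hεn] at this
    · simp only [fun n => fof_cplx (D n), hFn']
      exact (cplx_cont.tendsto _).comp (hFt z)
  have hGa : AnalyticOnNhd ℝ G Set.univ := by
    refine analytic_limit G (fun n => fof (S n).Hc (S n).Kc (cplx (-(S n).ρ))) (fun n => fof_diff (D n).dH (D n).dK _)
      ε hpos hhalf (fun n z hz => ?_) (fun z => ?_)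
    · have := (hR n).dGc z hz
      rwa [hεn] at this
    · simp only [fun n => fof_cplx (D n), hGn']
      exact (cplx_cont.tendsto _).comp (hGt z)
  -- iterates
  have hit : ∀ n k, k ≤ (S n).N → ∀ z, dist (F^[k] z) ((Fn n)^[k] z) ≤ (1/2)^n := by
    intro n k hk z
    have := (hS n).iter F (fun z => by rw [hFn', hεn, dist_comm]; exact hFd z n) k hk z
    rwa [hFn'] at this
  have hpow : ∀ e : ℝ, 0 < e → ∃ n : ℕ, (1/2 : ℝ)^n < e := fun e he => exists_pow_lt_of_lt_one he (by norm_num)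
  have hρN : ∀ n, ∀ k ≤ (S n).N, dist ((k:ℝ) • ρ) ((k:ℝ) • (S n).ρ) ≤ (1/2)^n := by
    intro n k hk
    rw [dist_smul₀, Real.norm_natCast]
    have h1 := hρd n
    rw [dist_comm] at h1
    have h2 := (hS n).epsN
    rw [hεn] at h2
    have h3 : (k:ℝ) ≤ (S n).N := by exact_mod_cast hk
    calc (k:ℝ) * dist ρ (S n).ρ ≤ (S n).N * ε n := by gcongr
      _ ≤ _ := by rw [mul_comm]; exact h2
  have hirr : LinearIndependent ℚ ![(1 : ℝ), ρ.1, ρ.2] := by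
    apply irr_lemma
    intro η hη w
    obtain ⟨n, hn⟩ := hpow (η/2) (by positivity)
    obtain ⟨k, hk, m, hm⟩ := (hS n).densρ w
    refine ⟨k, m, ?_⟩
    have h1 := hρN n k hk
    have h2 := dist_triangle ((k:ℝ) • ρ + latv m) ((k:ℝ) • (S n).ρ + latv m) w
    rw [dist_add_right] at h2
    linarith
  have hrot : ∀ e > 0, ∃ N : ℕ, 1 ≤ N ∧ ∀ z, ‖F^[N] z - z - (N:ℝ) • ρ‖ ≤ e * N := by
    intro e he
    obtain ⟨n, hn⟩ := hpow (e/3) (by positivity)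
    refine ⟨(S n).N, (hS n).N1, fun z => ?_⟩
    have hN1 : (1:ℝ) ≤ (S n).N := by exact_mod_cast (hS n).N1
    have h1 := hit n _ le_rfl z
    have h2 := (hS n).rot z
    rw [hFn'] at h2
    have h3 := hρN n _ le_rfl
    rw [dist_eq_norm] at h1 h3
    have e1 : F^[(S n).N] z - z - ((S n).N:ℝ) • ρ = (F^[(S n).N] z - (Fn n)^[(S n).N] z) +
      ((Fn n)^[(S n).N] z - z - ((S n).N:ℝ) • (S n).ρ) - (((S n).N:ℝ) • ρ - ((S n).N:ℝ) • (S n).ρ) := by abel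
    rw [e1]
    have e2 := norm_sub_le ((F^[(S n).N] z - (Fn n)^[(S n).N] z) +
      ((Fn n)^[(S n).N] z - z - ((S n).N:ℝ) • (S n).ρ)) (((S n).N:ℝ) • ρ - ((S n).N:ℝ) • (S n).ρ)
    have e3 := norm_add_le (F^[(S n).N] z - (Fn n)^[(S n).N] z)
      ((Fn n)^[(S n).N] z - z - ((S n).N:ℝ) • (S n).ρ)
    have e4 : (1/2:ℝ)^n * (S n).N ≤ e/3 * (S n).N := by gcongr
    have e5 : e/3 * 1 ≤ e/3 * (S n).N := by gcongr
    linarith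
  obtain ⟨C, hC⟩ := equi_bdd hFE hFc
  have hdense : ∀ z : Circ × Circ, Dense {w | ∃ n : ℕ, (desc F)^[n] z = w ∨ (desc G)^[n] z = w} := by
    intro z
    obtain ⟨z, rfl⟩ := proj_surj z
    rw [Metric.dense_iff]
    intro w r hr
    obtain ⟨w, rfl⟩ := proj_surj w
    obtain ⟨n, hn⟩ := hpow (r/2) (by positivity)
    obtain ⟨k, hk, m, hm⟩ := (hS n).dens z w
    rw [hFn'] at hm
    refine ⟨(desc F)^[k] (torusProj z), ?_, k, Or.inl rfl⟩
    rw [Metric.mem_ball, desc_iter hFE]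
    have h0 : torusProj (F^[k] z) = torusProj (F^[k] z + latv m) := ((proj_eq _ _).2 ⟨m, rfl⟩).symm
    rw [h0]
    refine (proj_dist _ _).trans_lt ?_
    have h1 := hit n k hk z
    have h2 := dist_triangle (F^[k] z + latv m) ((Fn n)^[k] z + latv m) w
    rw [dist_add_right] at h2
    linarith
  have hpf : ∀ z, p (desc F z) = p z + ((ρ.1 : ℝ) : Circ) := by
    intro z
    obtain ⟨z, rfl⟩ := proj_surj z
    rw [desc_proj hFE]
    -- value at stage n
    have hv : ∀ n, (desc (S n).K (torusProj (Fn n z))).1 = (desc (S n).K (torusProj z)).1 + (((S n).ρ.1 : ℝ) : Circ) := by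
      intro n
      rw [desc_proj (D n).eK, desc_proj (D n).eK, ← hFn', fof, (D n).KH, proj_add]
      rfl
    have hcirc : Continuous (fun x : ℝ => (x : Circ)) := AddCircle.continuous_mk' 1
    have t1 : Filter.Tendsto (fun n => p (torusProj (Fn n z))) Filter.atTop (nhds (p (torusProj (F z)))) :=
      ((hpc.comp proj_quot.continuous).tendsto _).comp (hFt z)
    have t2 : Filter.Tendsto (fun n => (desc (S n).K (torusProj z)).1 + (((S n).ρ.1 : ℝ) : Circ)) Filter.atTop
        (nhds (p (torusProj z) + ((ρ.1 : ℝ) : Circ))) :=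
      (hpt _).add (((hcirc.comp continuous_fst).tendsto _).comp hρt)
    have t3 : Filter.Tendsto (fun n => p (torusProj (Fn n z))) Filter.atTop (nhds (p (torusProj z) + ((ρ.1 : ℝ) : Circ))) := by
      refine t2.congr_dist ?_
      refine squeeze_zero (fun _ => dist_nonneg) (fun n => ?_) hε0
      rw [← hv]
      exact hpd _ n
    exact tendsto_nhds_unique t1 t3
  have hgf : ∀ w, desc G (desc F w) = w := desc_inv hGE hFE hGF
  have hfg : ∀ w, desc F (desc G w) = w := desc_inv hFE hGE hFG
  refine ⟨F, ρ, p, desc F, desc G, hFa, ⟨G, hGa, hGF, hFG⟩, hFE, hmp, desc_proj hFE, desc_cont hFE hFc, desc_cont hGE hGc,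
    hgf, hfg, desc_mp hFE hFc hGc hFG hGF hmp, hirr, fun e he => rot_lemma C hC hrot e he, hdense, hpc, hps, hpf, hpp, ?_⟩
  intro x
  ext w
  constructor
  · rintro ⟨y, hy, rfl⟩
    have hy' : p y = x := hy
    show p (desc F y) = _
    rw [hpf, hy']
  · intro hw
    refine ⟨desc G w, ?_, hfg w⟩
    have hw' : p w = x + ((ρ.1 : ℝ) : Circ) := hw
    show p (desc G w) = x
    have := hpf (desc G w)
    rw [hfg, hw'] at this
    exact (add_right_cancel this).symm
end

section
/- For every ε > 0 there exists a continuous surjective map g : [0,1] → [0,1] with g(0) = 0 and g(1) = 1 which is ε-crooked: for all a, b with 0 ≤ a < b ≤ 1 there exist c, d with a < c < d < b such that |g(d) − g(a)| < ε and |g(c) − g(b)| < ε. -/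
/-- Weak crookedness (tolerance `1`) of `f` between `a` and `b`. -/
def WCrook (f : ℝ → ℝ) (a b : ℝ) : Prop :=
  ∃ c d : ℝ, a ≤ c ∧ c ≤ d ∧ d ≤ b ∧ |f c - f b| ≤ 1 ∧ |f d - f a| ≤ 1

/-- The inductive invariant: `Q` on `[0,T]` climbs from `0` to `h`, is weakly crooked, and its final
part of length `S` is its initial part shifted up by `1`. -/
structure Good_s3 (Q : ℝ → ℝ) (S T h : ℝ) : Prop where
  cont : Continuous Q
  S0 : 0 ≤ S
  ST : S ≤ T
  T0 : 0 < T
  h1 : 1 ≤ h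
  q0 : Q 0 = 0
  qT : Q T = h
  lo : ∀ x, 0 ≤ x → x ≤ T → 0 ≤ Q x
  hi : ∀ x, 0 ≤ x → x ≤ T → Q x ≤ h
  sh : ∀ t, 0 ≤ t → t ≤ S → Q (T - S + t) = Q t + 1
  cr : ∀ a b, 0 ≤ a → a ≤ b → b ≤ T → WCrook Q a b

lemma good_base : Good_s3 (fun x => x) 0 1 1 where
  cont := continuous_id
  S0 := le_refl _
  ST := by norm_num
  T0 := by norm_num
  h1 := by norm_num
  q0 := rfl
  qT := rfl
  lo := fun x hx _ => hx
  hi := fun x _ hx => hx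
  sh := fun t h0 h1 => by simp; ring
  cr := fun a b h0 h1 h2 =>
    ⟨a, b, le_refl _, h1, le_refl _, by rw [abs_le]; constructor <;> linarith,
      by rw [abs_le]; constructor <;> linarith⟩

lemma WCrook.left {f : ℝ → ℝ} {a a' b : ℝ} (h : WCrook f a' b) (h1 : a ≤ a') (h2 : f a' = f a) :
    WCrook f a b := by
  obtain ⟨c, d, k1, k2, k3, k4, k5⟩ := h
  exact ⟨c, d, h1.trans k1, k2, k3, k4, h2 ▸ k5⟩

lemma WCrook.right {f : ℝ → ℝ} {a b b' : ℝ} (h : WCrook f a b') (h1 : b' ≤ b) (h2 : f b' = f b) :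
    WCrook f a b := by
  obtain ⟨c, d, k1, k2, k3, k4, k5⟩ := h
  exact ⟨c, d, k1, k2, k3.trans h1, h2 ▸ k4, k5⟩

lemma ivt_up {f : ℝ → ℝ} (hf : Continuous f) {x y v : ℝ} (h : x ≤ y) (h1 : f x ≤ v) (h2 : v ≤ f y) :
    ∃ c, x ≤ c ∧ c ≤ y ∧ f c = v := by
  obtain ⟨c, hc, e⟩ := intermediate_value_Icc h hf.continuousOn ⟨h1, h2⟩
  exact ⟨c, hc.1, hc.2, e⟩

lemma ivt_down {f : ℝ → ℝ} (hf : Continuous f) {x y v : ℝ} (h : x ≤ y) (h1 : f y ≤ v)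
    (h2 : v ≤ f x) : ∃ c, x ≤ c ∧ c ≤ y ∧ f c = v := by
  obtain ⟨c, hc, e⟩ := intermediate_value_Icc' h hf.continuousOn ⟨h1, h2⟩
  exact ⟨c, hc.1, hc.2, e⟩

lemma good_step {Q : ℝ → ℝ} {S T h : ℝ} (g : Good_s3 Q S T h) :
    ∃ R : ℝ → ℝ, Good_s3 R T (2 * T + S) (h + 1) := by
  obtain ⟨cont, S0, ST, T0, h1, q0, qT, lo, hi, sh, cr⟩ := g
  have qTS : Q (T - S) = 1 := by have := sh 0 le_rfl S0; rw [add_zero, q0] at this; linarith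
  have qS : Q S + 1 = h := by rw [← sh S S0 le_rfl, ← qT]; ring_nf
  obtain ⟨R, Rc, R1, R2, R3⟩ : ∃ R : ℝ → ℝ, Continuous R ∧ (∀ x, x ≤ T → R x = Q x) ∧
      (∀ x, T ≤ x → x ≤ T + S → R x = Q (2 * T - x)) ∧
      (∀ x, T + S ≤ x → R x = Q (x - T - S) + 1) := by
    refine ⟨fun x => if x ≤ T then Q x else if x ≤ T + S then Q (2 * T - x) else Q (x - T - S) + 1,
      ?_, ?_, ?_, ?_⟩
    · refine Continuous.if_le cont ?_ continuous_id continuous_const ?_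
      · refine Continuous.if_le (by fun_prop) (by fun_prop) continuous_id continuous_const ?_
        intro x hx
        subst hx
        rw [show 2 * T - (T + S) = T - S by ring, qTS, show T + S - T - S = 0 by ring, q0]; ring
      · intro x hx
        subst hx
        rw [if_pos (by linarith)]; ring_nf
    · intro x hx
      simp only [if_pos hx]
    · intro x hx hx'
      by_cases h : x ≤ T
      · have : x = T := le_antisymm h hx
        subst this
        simp only [if_pos h]; ring_nf
      · simp only [if_neg h, if_pos hx']
    · intro x hx
      by_cases h : x ≤ T + S
      · have : x = T + S := le_antisymm h hx
        subst this
        by_cases h' : T + S ≤ T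
        · have : S = 0 := by linarith
          subst this
          simp only [if_pos h']
          rw [show T + 0 - T - 0 = 0 by ring, q0, add_zero, qT, ← qS, q0]
        · simp only [if_neg h', if_pos h]
          rw [show 2 * T - (T + S) = T - S by ring, qTS, show T + S - T - S = 0 by ring, q0]; ring
      · have h' : ¬ x ≤ T := by intro h'; apply h; linarith
        simp only [if_neg h, if_neg h']
  have m1 : ∀ x, T - S ≤ x → x ≤ T → R (2 * T - x) = R x := by
    intro x h h'
    rw [R1 x h', R2 _ (by linarith) (by linarith)]; ring_nf
  have m1' : ∀ x, T ≤ x → x ≤ T + S → R (2 * T - x) = R x := by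
    intro x h h'
    rw [R2 x h h', R1 _ (by linarith)]
  have m2 : ∀ x, T ≤ x → x ≤ T + S → R (2 * (T + S) - x) = R x := by
    intro x h h'
    rw [R2 x h h', R3 _ (by linarith), show 2 * (T + S) - x - T - S = T + S - x by ring,
      ← sh _ (by linarith) (by linarith)]
    ring_nf
  have m2' : ∀ x, T + S ≤ x → x ≤ T + 2 * S → R (2 * (T + S) - x) = R x := by
    intro x h h'
    rw [← m2 (2 * (T + S) - x) (by linarith) (by linarith)]; ring_nf
  have c1 : ∀ a b, 0 ≤ a → a ≤ b → b ≤ T → WCrook R a b := by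
    intro a b h0 hab hb
    obtain ⟨c, d, k1, k2, k3, k4, k5⟩ := cr a b h0 hab hb
    refine ⟨c, d, k1, k2, k3, ?_, ?_⟩
    · rwa [R1 c (by linarith), R1 b (by linarith)]
    · rwa [R1 d (by linarith), R1 a (by linarith)]
  have c2 : ∀ a b, T ≤ a → a ≤ b → b ≤ T + S → WCrook R a b := by
    intro a b h0 hab hb
    obtain ⟨c, d, k1, k2, k3, k4, k5⟩ :=
      cr (2 * T - b) (2 * T - a) (by linarith) (by linarith) (by linarith)
    refine ⟨2 * T - d, 2 * T - c, by linarith, by linarith, by linarith, ?_, ?_⟩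
    · rw [R2 b (by linarith) (by linarith), R2 (2 * T - d) (by linarith) (by linarith)]
      simpa using k5
    · rw [R2 a (by linarith) (by linarith), R2 (2 * T - c) (by linarith) (by linarith)]
      simpa using k4
  have c3 : ∀ a b, T + S ≤ a → a ≤ b → b ≤ 2 * T + S → WCrook R a b := by
    intro a b h0 hab hb
    obtain ⟨c, d, k1, k2, k3, k4, k5⟩ :=
      cr (a - T - S) (b - T - S) (by linarith) (by linarith) (by linarith)
    refine ⟨c + T + S, d + T + S, by linarith, by linarith, by linarith, ?_, ?_⟩
    · rw [R3 b (by linarith), R3 (c + T + S) (by linarith),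
        show c + T + S - T - S = c by ring]
      simpa using k4
    · rw [R3 a (by linarith), R3 (d + T + S) (by linarith),
        show d + T + S - T - S = d by ring]
      simpa using k5
  have c4 : ∀ a b, 0 ≤ a → a ≤ T → T ≤ b → b ≤ T + S → WCrook R a b := by
    intro a b h0 ha hb hb'
    rcases le_total a (2 * T - b) with h | h
    · exact (c1 a (2 * T - b) h0 h (by linarith)).right (by linarith) (m1' b hb hb')
    · exact (c2 (2 * T - a) b (by linarith) (by linarith) hb').left (by linarith)
        (m1 a (by linarith) ha)
  have c5 : ∀ a b, T ≤ a → a ≤ T + S → T + S ≤ b → b ≤ 2 * T + S → WCrook R a b := by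
    intro a b h0 ha hb hb'
    rcases le_total (2 * (T + S) - a) b with h | h
    · exact (c3 (2 * (T + S) - a) b (by linarith) h hb').left (by linarith) (m2 a h0 ha)
    · exact (c2 a (2 * (T + S) - b) h0 (by linarith) (by linarith)).right (by linarith)
        (m2' b hb (by linarith))
  have RT : R T = h := by rw [R1 T le_rfl, qT]
  have RTS : R (T + S) = 1 := by
    rw [R3 _ le_rfl, show T + S - T - S = 0 by ring, q0]; ring
  have RTmS : R (T - S) = 1 := by rw [R1 _ (by linarith), qTS]
  have RT2S : R (T + 2 * S) = h := by
    rw [R3 _ (by linarith), show T + 2 * S - T - S = S by ring, qS]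
  have c6 : ∀ a b, 0 ≤ a → a ≤ T → T + S ≤ b → b ≤ 2 * T + S → WCrook R a b := by
    intro a b h0 ha hb hb'
    rcases le_total b (T + 2 * S) with h2 | h2
    · exact (c4 a (2 * (T + S) - b) h0 ha (by linarith) (by linarith)).right (by linarith)
        (m2' b hb h2)
    rcases le_total (T - S) a with h3 | h3
    · exact (c5 (2 * T - a) b (by linarith) (by linarith) hb hb').left (by linarith) (m1 a h3 ha)
    have u0 : 0 ≤ R a := by rw [R1 a ha]; exact lo a h0 ha
    have u1 : R a ≤ h := by rw [R1 a ha]; exact hi a h0 ha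
    have v0 : 1 ≤ R b := by
      rw [R3 b hb]; linarith [lo (b - T - S) (by linarith) (by linarith)]
    have v1 : R b ≤ h + 1 := by
      rw [R3 b hb]; linarith [hi (b - T - S) (by linarith) (by linarith)]
    rcases le_total (R a) (R b) with hv | hv
    · obtain ⟨c, hc, hc', ec⟩ := ivt_up Rc (v := min (R b) h) ha (le_min hv u1)
        (by rw [RT]; exact min_le_right _ _)
      obtain ⟨d, hd, hd', ed⟩ := ivt_up Rc (v := max (R a) 1) hb
        (by rw [RTS]; exact le_max_right _ _) (max_le hv v0)
      refine ⟨c, d, hc, by linarith, hd', ?_, ?_⟩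
      · rw [ec, abs_le]
        rcases min_cases (R b) h with ⟨e, _⟩ | ⟨e, _⟩ <;> rw [e] <;> constructor <;> linarith
      · rw [ed, abs_le]
        rcases max_cases (R a) 1 with ⟨e, _⟩ | ⟨e, _⟩ <;> rw [e] <;> constructor <;> linarith
    · obtain ⟨c, hc, hc', ec⟩ := ivt_down Rc (v := R b) h3 (by rw [RTmS]; exact v0) hv
      obtain ⟨d, hd, hd', ed⟩ := ivt_up Rc (v := R a) (show T + S ≤ T + 2 * S by linarith)
        (by rw [RTS]; linarith) (by rw [RT2S]; exact u1)
      refine ⟨c, d, hc, by linarith, by linarith, ?_, ?_⟩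
      · rw [ec]; simp
      · rw [ed]; simp
  refine ⟨R, Rc, T0.le, by linarith, by linarith, by linarith, ?_, ?_, ?_, ?_, ?_, ?_⟩
  · rw [R1 0 T0.le, q0]
  · rw [R3 _ (by linarith), show 2 * T + S - T - S = T by ring, qT]
  · intro x hx hx'
    rcases le_total x T with h2 | h2
    · rw [R1 x h2]; exact lo x hx h2
    rcases le_total x (T + S) with h3 | h3
    · rw [R2 x h2 h3]; exact lo _ (by linarith) (by linarith)
    · rw [R3 x h3]; linarith [lo (x - T - S) (by linarith) (by linarith)]
  · intro x hx hx'
    rcases le_total x T with h2 | h2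
    · rw [R1 x h2]; linarith [hi x hx h2]
    rcases le_total x (T + S) with h3 | h3
    · rw [R2 x h2 h3]; linarith [hi (2 * T - x) (by linarith) (by linarith)]
    · rw [R3 x h3]; linarith [hi (x - T - S) (by linarith) (by linarith)]
  · intro t h0 ht
    rw [R1 t ht, R3 _ (by linarith)]; ring_nf
  · intro a b h0 hab hb
    rcases le_total b T with hb1 | hb1
    · exact c1 a b h0 hab hb1
    rcases le_total b (T + S) with hb2 | hb2
    · rcases le_total a T with ha | ha
      · exact c4 a b h0 ha hb1 hb2
      · exact c2 a b ha hab hb2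
    · rcases le_total a T with ha | ha
      · exact c6 a b h0 ha hb2 hb
      rcases le_total a (T + S) with ha2 | ha2
      · exact c5 a b ha ha2 hb2 hb
      · exact c3 a b ha2 hab hb

lemma good_exists (n : ℕ) : ∃ (Q : ℝ → ℝ) (S T : ℝ), Good_s3 Q S T (n + 1) := by
  induction n with
  | zero => exact ⟨_, 0, 1, by simpa using good_base⟩
  | succ k ih =>
    obtain ⟨Q, S, T, g⟩ := ih
    obtain ⟨R, hR⟩ := good_step g
    exact ⟨R, _, _, by push_cast; exact hR⟩

/-- For every `ε > 0` there exists a continuous surjective map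
`g : [0,1] → [0,1]` with `g 0 = 0` and `g 1 = 1` which is `ε`-crooked. -/
theorem exists_crooked_map (ε : ℝ) (hε : 0 < ε) :
    ∃ g : ℝ → ℝ, ContinuousOn g (Set.Icc 0 1) ∧
      g '' Set.Icc 0 1 = Set.Icc 0 1 ∧ g 0 = 0 ∧ g 1 = 1 ∧
      ∀ a b : ℝ, a ∈ Set.Icc (0:ℝ) 1 → b ∈ Set.Icc (0:ℝ) 1 → a < b →
        ∃ c d : ℝ, a < c ∧ c < d ∧ d < b ∧ |g d - g a| < ε ∧ |g c - g b| < ε := by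
  obtain ⟨n, hn⟩ := exists_nat_gt (2 / ε)
  obtain ⟨Q, S, T, gd⟩ := good_exists n
  have hpos : (0:ℝ) < n + 1 := by positivity
  have hT := gd.T0
  have hδ : 2 * (1 / ((n:ℝ) + 1)) < ε := by
    rw [div_lt_iff₀ hε] at hn
    rw [mul_one_div, div_lt_iff₀ hpos]
    nlinarith
  have hδ0 : 0 < 1 / ((n:ℝ) + 1) := by positivity
  set δ := 1 / ((n:ℝ) + 1) with hδdef
  obtain ⟨g, hg⟩ : ∃ g : ℝ → ℝ, g = fun x => Q (T * x) / (n + 1) := ⟨_, rfl⟩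
  have gc : Continuous g := by
    have := gd.cont
    rw [hg]; fun_prop
  have g0 : g 0 = 0 := by rw [hg]; simp [gd.q0]
  have g1 : g 1 = 1 := by rw [hg]; simp only [mul_one, gd.qT]; exact div_self hpos.ne'
  have gw : ∀ a b : ℝ, 0 ≤ a → a ≤ b → b ≤ 1 →
      ∃ c d : ℝ, a ≤ c ∧ c ≤ d ∧ d ≤ b ∧ |g d - g a| ≤ δ ∧ |g c - g b| ≤ δ := by
    intro a b h0 hab hb
    obtain ⟨c, d, k1, k2, k3, k4, k5⟩ := gd.cr (T * a) (T * b) (by positivity) (by gcongr)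
      (by nlinarith)
    refine ⟨c / T, d / T, ?_, ?_, ?_, ?_, ?_⟩
    · rw [le_div_iff₀ hT]; linarith
    · gcongr
    · rw [div_le_iff₀ hT]; linarith
    · simp only [hg, mul_div_cancel₀ _ hT.ne']
      rw [← sub_div, abs_div, abs_of_pos hpos, hδdef]
      gcongr
    · simp only [hg, mul_div_cancel₀ _ hT.ne']
      rw [← sub_div, abs_div, abs_of_pos hpos, hδdef]
      gcongr
  have close : ∀ a b : ℝ, a < b → |g b - g a| < ε →
      ∃ c d : ℝ, a < c ∧ c < d ∧ d < b ∧ |g d - g a| < ε ∧ |g c - g b| < ε := by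
    intro a b hab h
    have hU : IsOpen {x | |g x - g a| < ε} := isOpen_lt (by fun_prop) (by fun_prop)
    have hV : IsOpen {x | |g x - g b| < ε} := isOpen_lt (by fun_prop) (by fun_prop)
    have hm : a < (a + b) / 2 := by linarith
    have hm' : (a + b) / 2 < b := by linarith
    have e1 := (mem_nhdsWithin_of_mem_nhds (t := Set.Ioi a) (hV.mem_nhds
      (show |g a - g b| < ε by rwa [abs_sub_comm])))
    have e2 := (mem_nhdsWithin_of_mem_nhds (t := Set.Iio b) (hU.mem_nhds (show |g b - g a| < ε from h)))
    obtain ⟨c, hc, hc'⟩ := (Filter.inter_mem e1 (Ioo_mem_nhdsGT hm)) |> Filter.nonempty_of_mem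
    obtain ⟨d, hd, hd'⟩ := (Filter.inter_mem e2 (Ioo_mem_nhdsLT hm')) |> Filter.nonempty_of_mem
    exact ⟨c, d, hc'.1, hc'.2.trans hd'.1, hd'.2, hd, hc⟩
  refine ⟨g, gc.continuousOn, ?_, g0, g1, ?_⟩
  · apply Set.Subset.antisymm
    · rintro _ ⟨x, hx, rfl⟩
      have h1 : 0 ≤ T * x := mul_nonneg hT.le hx.1
      have h2 : T * x ≤ T := by nlinarith [hx.2]
      rw [hg]
      refine ⟨div_nonneg (gd.lo _ h1 h2) hpos.le, ?_⟩
      simp only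
      rw [div_le_one hpos]
      exact gd.hi _ h1 h2
    · have := intermediate_value_Icc (zero_le_one (α := ℝ)) gc.continuousOn
      rwa [g0, g1] at this
  · intro a b ha hb hab
    by_cases h : |g b - g a| < ε
    · exact close a b hab h
    obtain ⟨c, d, k1, k2, k3, k4, k5⟩ := gw a b ha.1 hab.le hb.2
    refine ⟨c, d, lt_of_le_of_ne k1 ?_, lt_of_le_of_ne k2 ?_, lt_of_le_of_ne k3 ?_,
      by linarith, by linarith⟩
    · rintro rfl
      apply h; rw [abs_sub_comm]; linarith
    · rintro rfl
      apply h
      have := abs_sub_le (g b) (g c) (g a)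
      rw [abs_sub_comm (g b) (g c)] at this
      linarith
    · rintro rfl
      apply h; linarith
end
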